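/- arXiv:math/0506088 — 2 statements merged into one kernel-verified Lean document; each statement's English description precedes it below -/
import Mathlib

section
/- Every polynomial f ∈ K[X] that is invariant under the diagonal action of GL_n(K) (i.e. f(UA, A^{-1}W) = f(U,W) for all A ∈ GL_n(K) and all (U,W) ∈ X) lies in the K-subalgebra of K[X] generated by the entries φ_{ij} (1 ≤ i ≤ m, 1 ≤ j ≤ q) of the product matrix UW. (First fundamental theorem for GL_n(K)-invariants.) -/
namespace SMB

/-- `geTup f g` : the strictly increasing tuple `f` is `≥` the strictly increasing tuple `g`
in the order on increasing tuples: the length of `f` is at most that of `g`, and `f` is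
entrywise `≥` `g` (on the common range of indices). -/
def geTup {N s s' : ℕ} (f : Fin s → Fin N) (g : Fin s' → Fin N) : Prop :=
  ∃ h : s ≤ s', ∀ j : Fin s, g (Fin.castLE h j) ≤ f j

/-- A strictly increasing `s`-tuple with values in `{1,…,N}` (encoded as `Fin N`). -/
structure IncTup (s N : ℕ) where
  f : Fin s → Fin N
  mono : StrictMono f

/-- A pair of strictly increasing tuples of a common length `s`: row indices in `{1,…,m}`
and column indices in `{1,…,q}`, indexing an `s × s` minor. -/
structure PairIx (m q : ℕ) where
  s : ℕ
  rows : Fin s → Fin m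
  cols : Fin s → Fin q
  rmono : StrictMono rows
  cmono : StrictMono cols

/-- The partial order `(A,B) ⪰ (A',B')` on pairs of increasing tuples: `A ≥ A'` and `B ≥ B'`. -/
def PairIx.ge {m q : ℕ} (x y : PairIx m q) : Prop :=
  geTup x.rows y.rows ∧ geTup x.cols y.cols

end SMB
namespace SMB

variable (K : Type) [Field K] (n m q : ℕ)

/-- The coordinate ring `K[X]` of `X = M_{m,n}(K) × M_{n,q}(K)`: the polynomial ring over `K`
in the entries of a generic `m×n` matrix `U` and a generic `n×q` matrix `W`. -/
abbrev KX := MvPolynomial ((Fin m × Fin n) ⊕ (Fin n × Fin q)) K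

/-- The generic `m×n` matrix `U = (u_{ij})`. -/
noncomputable def Ugen : Matrix (Fin m) (Fin n) (KX K n m q) :=
  Matrix.of fun i j => MvPolynomial.X (Sum.inl (i, j))

/-- The generic `n×q` matrix `W = (ξ_{kl})`. -/
noncomputable def Wgen : Matrix (Fin n) (Fin q) (KX K n m q) :=
  Matrix.of fun k l => MvPolynomial.X (Sum.inr (k, l))

/-- `φ_{ij}`, the `(i,j)` entry of the product matrix `UW`. -/
noncomputable def phi (i : Fin m) (j : Fin q) : KX K n m q :=
  (Ugen K n m q * Wgen K n m q) i j

/-- Evaluation of a polynomial in `K[X]` at a point `(U, W) ∈ X`. -/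
noncomputable def evalX (U : Matrix (Fin m) (Fin n) K) (W : Matrix (Fin n) (Fin q) K) :
    KX K n m q →+* K :=
  MvPolynomial.eval (Sum.elim (fun p => U p.1 p.2) (fun p => W p.1 p.2))

variable {K n m q}

/-- `f ∈ K[X]` is invariant under the diagonal action of `GL_n(K)`:
`f(UA, A⁻¹W) = f(U, W)` for all `A ∈ GL_n(K)` and all `(U,W) ∈ X`. -/
def IsGLInvariant (f : KX K n m q) : Prop :=
  ∀ (A : GL (Fin n) K) (U : Matrix (Fin m) (Fin n) K) (W : Matrix (Fin n) (Fin q) K),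
    evalX K n m q (U * (A : Matrix (Fin n) (Fin n) K))
      (((A⁻¹ : GL (Fin n) K) : Matrix (Fin n) (Fin n) K) * W) f = evalX K n m q U W f

/-- `f ∈ K[X]` is invariant under the diagonal action of `SL_n(K)`:
`f(UA, A⁻¹W) = f(U, W)` for all `A ∈ SL_n(K)` and all `(U,W) ∈ X`. -/
def IsSLInvariant (f : KX K n m q) : Prop :=
  ∀ (A : Matrix.SpecialLinearGroup (Fin n) K)
    (U : Matrix (Fin m) (Fin n) K) (W : Matrix (Fin n) (Fin q) K),
    evalX K n m q (U * (A : Matrix (Fin n) (Fin n) K))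
      (((A⁻¹ : Matrix.SpecialLinearGroup (Fin n) K) : Matrix (Fin n) (Fin n) K) * W) f
      = evalX K n m q U W f

variable (K n m q)

end SMB

namespace SMB
open MvPolynomial

section Extraction

variable {ι R M M' : Type*} [CommRing R] [AddCommMonoid M']
  [AddCommMonoid M] [LinearOrder M] [IsOrderedCancelAddMonoid M]

/-- The part of a polynomial supported on the exponents satisfying `p`. -/
noncomputable def part (p : (ι →₀ ℕ) → Prop) [DecidablePred p] (f : MvPolynomial ι R) :
    MvPolynomial ι R :=
  ∑ e ∈ f.support with p e, monomial e (coeff e f)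

theorem coeff_part (p : (ι →₀ ℕ) → Prop) [DecidablePred p] (f : MvPolynomial ι R) (d : ι →₀ ℕ) :
    coeff d (part p f) = if p d then coeff d f else 0 := by
  classical
  simp only [part, coeff_sum, coeff_monomial, Finset.sum_ite_eq', Finset.mem_filter,
    mem_support_iff]
  split_ifs <;> simp_all

theorem mem_support_part {p : (ι →₀ ℕ) → Prop} [DecidablePred p] {f : MvPolynomial ι R}
    {d : ι →₀ ℕ} : d ∈ (part p f).support ↔ p d ∧ d ∈ f.support := by
  simp only [mem_support_iff, coeff_part]
  split_ifs <;> simp_all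

theorem coeff_map_eq_sum (ε : MvPolynomial ι R →ₐ[R] MvPolynomial ι R) (f : MvPolynomial ι R)
    (d : ι →₀ ℕ) :
    coeff d (ε f) = ∑ e ∈ f.support, coeff e f * coeff d (ε (monomial e 1)) := by
  conv_lhs => rw [f.as_sum]
  rw [map_sum, coeff_sum]
  refine Finset.sum_congr rfl fun e _ => ?_
  rw [← coeff_C_mul, ← algebraMap_eq, ← ε.commutes, ← map_mul, algebraMap_eq, C_mul_monomial,
    mul_one]

/-- If `ε` agrees with the `G`-homogeneous map `ε'` up to terms of lower `ω`-weight on the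
variables, then it does so on all monomials. -/
theorem triangular_monomial (G : (ι →₀ ℕ) →+ M') (ω : (ι →₀ ℕ) →+ M)
    (hGω : ∀ d d', G d = G d' → ω d = ω d')
    {ε ε' : MvPolynomial ι R →ₐ[R] MvPolynomial ι R}
    (h1 : ∀ k, ∀ d ∈ (ε' (X k)).support, G d = G (Finsupp.single k 1))
    (h2 : ∀ k, ∀ d ∈ (ε (X k) - ε' (X k)).support, ω d < ω (Finsupp.single k 1))
    (e : ι →₀ ℕ) :
    (∀ d ∈ (ε' (monomial e 1)).support, G d = G e) ∧
      ∀ d ∈ (ε (monomial e 1) - ε' (monomial e 1)).support, ω d < ω e := by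
  classical
  have hadd : ∀ e f : ι →₀ ℕ,
      ((∀ d ∈ (ε' (monomial e 1)).support, G d = G e) ∧
        ∀ d ∈ (ε (monomial e 1) - ε' (monomial e 1)).support, ω d < ω e) →
      ((∀ d ∈ (ε' (monomial f 1)).support, G d = G f) ∧
        ∀ d ∈ (ε (monomial f 1) - ε' (monomial f 1)).support, ω d < ω f) →
      ((∀ d ∈ (ε' (monomial (e + f) 1)).support, G d = G (e + f)) ∧
        ∀ d ∈ (ε (monomial (e + f) 1) - ε' (monomial (e + f) 1)).support, ω d < ω (e + f)) := by
    rintro e f ⟨he1, he2⟩ ⟨hf1, hf2⟩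
    have hm : (monomial (e + f) (1 : R)) = monomial e 1 * monomial f 1 := by
      rw [monomial_mul, one_mul]
    constructor
    · intro d hd
      rw [hm, map_mul] at hd
      obtain ⟨a, ha, b, hb, rfl⟩ := Finset.mem_add.1 (support_mul _ _ hd)
      rw [map_add, map_add, he1 a ha, hf1 b hb]
    · intro d hd
      have : ε (monomial (e + f) 1) - ε' (monomial (e + f) 1)
          = (ε (monomial e 1) - ε' (monomial e 1)) * (ε (monomial f 1) - ε' (monomial f 1))
            + (ε (monomial e 1) - ε' (monomial e 1)) * ε' (monomial f 1)
            + ε' (monomial e 1) * (ε (monomial f 1) - ε' (monomial f 1)) := by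
        rw [hm, map_mul, map_mul]; ring
      rw [this] at hd
      rcases Finset.mem_union.1 (support_add hd) with hd | hd
      · rcases Finset.mem_union.1 (support_add hd) with hd | hd
        · obtain ⟨a, ha, b, hb, rfl⟩ := Finset.mem_add.1 (support_mul _ _ hd)
          rw [map_add, map_add]
          exact add_lt_add (he2 a ha) (hf2 b hb)
        · obtain ⟨a, ha, b, hb, rfl⟩ := Finset.mem_add.1 (support_mul _ _ hd)
          rw [map_add, map_add, hGω _ _ (hf1 b hb)]
          exact add_lt_add_left (he2 a ha) _
      · obtain ⟨a, ha, b, hb, rfl⟩ := Finset.mem_add.1 (support_mul _ _ hd)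
        rw [map_add, map_add, hGω _ _ (he1 a ha)]
        exact add_lt_add_right (hf2 b hb) _
  have h0 : (∀ d ∈ (ε' (monomial 0 1)).support, G d = G 0) ∧
        ∀ d ∈ (ε (monomial 0 1) - ε' (monomial 0 1)).support, ω d < ω 0 := by
    have h10 : (monomial (0 : ι →₀ ℕ) (1 : R)) = 1 := rfl
    constructor
    · intro d hd
      rw [h10, map_one] at hd
      have : d = 0 := by
        by_contra h
        rw [mem_support_iff, coeff_one, if_neg (Ne.symm h)] at hd
        exact hd rfl
      rw [this]
    · intro d hd
      rw [h10, map_one, map_one, sub_self] at hd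
      simp at hd
  induction e using Finsupp.induction_linear with
  | zero => exact h0
  | add e f he hf => exact hadd e f he hf
  | single k n =>
    induction n with
    | zero => simpa using h0
    | succ n ih =>
      rw [Finsupp.single_add]
      exact hadd _ _ ih ⟨h1 k, h2 k⟩

/-- The part of highest weight of an `ε`-invariant polynomial is `ε'`-invariant. -/
theorem fixed_part (G : (ι →₀ ℕ) →+ M') (ω : (ι →₀ ℕ) →+ M)
    (hGω : ∀ d d', G d = G d' → ω d = ω d')
    {ε ε' : MvPolynomial ι R →ₐ[R] MvPolynomial ι R}
    (h1 : ∀ k, ∀ d ∈ (ε' (X k)).support, G d = G (Finsupp.single k 1))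
    (h2 : ∀ k, ∀ d ∈ (ε (X k) - ε' (X k)).support, ω d < ω (Finsupp.single k 1))
    {f : MvPolynomial ι R} (hf : ε f = f) {e₀ : ι →₀ ℕ}
    (hmax : ∀ e ∈ f.support, ω e ≤ ω e₀)
    [DecidablePred fun e => G e = G e₀] :
    ε' (part (fun e => G e = G e₀) f) = part (fun e => G e = G e₀) f := by
  classical
  have key := triangular_monomial G ω hGω h1 h2
  ext d
  have hL : coeff d (ε' (part (fun e => G e = G e₀) f)) = ∑ e ∈ f.support,
      if G e = G e₀ then coeff e f * coeff d (ε' (monomial e 1)) else 0 := by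
    rw [coeff_map_eq_sum, ← Finset.sum_filter]
    have : (part (fun e => G e = G e₀) f).support = f.support.filter fun e => G e = G e₀ := by
      ext e
      rw [mem_support_part, Finset.mem_filter, and_comm]
    rw [this]
    refine Finset.sum_congr rfl fun e he => ?_
    rw [coeff_part, if_pos (Finset.mem_filter.1 he).2]
  rw [hL, coeff_part]
  split_ifs with hd
  · conv_rhs => rw [← hf]
    rw [coeff_map_eq_sum]
    refine Finset.sum_congr rfl fun e he => ?_
    have hdiff : coeff d (ε (monomial e 1)) = coeff d (ε' (monomial e 1)) := by
      by_contra h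
      have hlt := (key e).2 d (by rwa [mem_support_iff, coeff_sub, sub_ne_zero])
      rw [hGω _ _ hd] at hlt
      exact absurd (hmax e he) (not_le.2 hlt)
    rw [hdiff]
    split_ifs with hG
    · rfl
    · have : coeff d (ε' (monomial e 1)) = 0 := by
        by_contra h
        exact hG (((key e).1 d (mem_support_iff.2 h)).symm.trans hd)
      rw [this, mul_zero]
  · refine Finset.sum_eq_zero fun e he => ?_
    split_ifs with hG
    · have : coeff d (ε' (monomial e 1)) = 0 := by
        by_contra h
        exact hd (((key e).1 d (mem_support_iff.2 h)).trans hG)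
      rw [this, mul_zero]
    · rfl

end Extraction
section Invariance

variable {K : Type} [Field K] {n m q : ℕ}

/-- The `k`-th torus weight of a monomial, computed from the variables of `U`. -/
def colWt (e : (Fin m × Fin n) ⊕ (Fin n × Fin q) →₀ ℕ) (k : Fin n) : ℕ :=
  ∑ i, e (Sum.inl (i, k))

/-- The `k`-th torus weight of a monomial, computed from the variables of `W`. -/
def rowWt (e : (Fin m × Fin n) ⊕ (Fin n × Fin q) →₀ ℕ) (k : Fin n) : ℕ :=
  ∑ l, e (Sum.inr (k, l))

/-- Substitution of the shear adding, in the rows satisfying `S`, column `j` of `U` to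
column `j'`. -/
noncomputable def shearU (S : Fin m → Prop) [DecidablePred S] (j j' : Fin n) :
    KX K n m q →ₐ[K] KX K n m q :=
  aeval (Sum.elim
    (fun p => if p.2 = j' ∧ S p.1 then X (Sum.inl p) + X (Sum.inl (p.1, j)) else X (Sum.inl p))
    (fun p => X (Sum.inr p)))

/-- Substitution by the action of the elementary matrix `1 + E_{jj'}`. -/
noncomputable def shear (j j' : Fin n) : KX K n m q →ₐ[K] KX K n m q :=
  aeval (Sum.elim
    (fun p => if p.2 = j' then X (Sum.inl p) + X (Sum.inl (p.1, j)) else X (Sum.inl p))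
    (fun p => if p.1 = j then X (Sum.inr p) - X (Sum.inr (j', p.2)) else X (Sum.inr p)))

theorem evalX_eq_eval (x : (Fin m × Fin n) ⊕ (Fin n × Fin q) → K)
    (U : Matrix (Fin m) (Fin n) K) (W : Matrix (Fin n) (Fin q) K)
    (hU : ∀ i k, U i k = x (Sum.inl (i, k))) (hW : ∀ k l, W k l = x (Sum.inr (k, l)))
    (f : KX K n m q) : evalX K n m q U W f = eval x f := by
  unfold evalX
  congr 2
  funext p
  rcases p with ⟨i, k⟩ | ⟨k, l⟩
  · exact hU i k
  · exact hW k l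

theorem eval_aeval (x : (Fin m × Fin n) ⊕ (Fin n × Fin q) → K)
    (g : (Fin m × Fin n) ⊕ (Fin n × Fin q) → KX K n m q) (f : KX K n m q) :
    eval x (aeval g f) = eval (fun k => eval x (g k)) f := by
  rw [← coe_aeval_eq_eval, ← coe_aeval_eq_eval]
  change (aeval x) (aeval g f) = aeval _ f
  rw [← AlgHom.comp_apply, comp_aeval]
  simp [coe_aeval_eq_eval]

theorem IsGLInvariant.shear_eq [Infinite K] {f : KX K n m q} (hf : IsGLInvariant f)
    {j j' : Fin n} (hj : j ≠ j') : shear j j' f = f := by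
  refine MvPolynomial.funext fun x => ?_
  let A : GL (Fin n) K := ⟨Matrix.transvection j j' 1, Matrix.transvection j j' (-1),
    by rw [Matrix.transvection_mul_transvection_same j j' hj]; simp,
    by rw [Matrix.transvection_mul_transvection_same j j' hj]; simp⟩
  have h := hf A (Matrix.of fun i k => x (Sum.inl (i, k))) (Matrix.of fun k l => x (Sum.inr (k, l)))
  rw [evalX_eq_eval x (Matrix.of fun i k => x (Sum.inl (i, k)))
    (Matrix.of fun k l => x (Sum.inr (k, l))) (fun _ _ => rfl) (fun _ _ => rfl)] at h
  rw [← h, shear, eval_aeval]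
  symm
  refine evalX_eq_eval _ _ _ (fun i k => ?_) (fun k l => ?_) f
  · by_cases hk : k = j'
    · subst hk
      simp [A]
    · simp [A, hk, Matrix.mul_transvection_apply_of_ne]
  · by_cases hk : k = j
    · subst hk
      change (Matrix.transvection k j' (-1) * _ : Matrix (Fin n) (Fin q) K) k l = _
      simp [sub_eq_add_neg]
    · change (Matrix.transvection j j' (-1) * _ : Matrix (Fin n) (Fin q) K) k l = _
      simp [hk, Matrix.transvection_mul_apply_of_ne]

theorem scale_monomial {ι R : Type*} [CommRing R] (c : ι → R) (e : ι →₀ ℕ) :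
    aeval (fun k => C (c k) * X k : ι → MvPolynomial ι R) (monomial e (1 : R))
      = monomial e (e.prod fun k r => c k ^ r) := by
  rw [aeval_monomial, map_one, one_mul, monomial_eq]
  simp only [mul_pow, Finsupp.prod, map_prod, map_pow, Finset.prod_mul_distrib]

theorem coeff_scale {ι R : Type*} [CommRing R] (c : ι → R) (f : MvPolynomial ι R) (e : ι →₀ ℕ) :
    coeff e (aeval (fun k => C (c k) * X k : ι → MvPolynomial ι R) f)
      = coeff e f * e.prod fun k r => c k ^ r := by
  classical
  rw [coeff_map_eq_sum, Finset.sum_congr rfl fun d _ => by rw [scale_monomial, coeff_monomial]]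
  simp only [mul_ite, mul_zero, Finset.sum_ite_eq', mem_support_iff]
  split_ifs with h
  · rfl
  · rw [not_not.1 h, zero_mul]

theorem IsGLInvariant.colWt_eq_rowWt [Infinite K] {f : KX K n m q} (hf : IsGLInvariant f)
    {e : (Fin m × Fin n) ⊕ (Fin n × Fin q) →₀ ℕ} (he : e ∈ f.support) :
    colWt e = rowWt e := by
  funext k
  have key : ∀ s : K, s ≠ 0 → s ^ colWt e k = s ^ rowWt e k := by
    intro s hs
    let c : Fin n → K := fun k' => if k' = k then s else 1
    have hc : ∀ k', c k' ≠ 0 := fun k' => by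
      by_cases h : k' = k <;> simp [c, h, hs]
    let A : GL (Fin n) K := ⟨Matrix.diagonal c, Matrix.diagonal fun k' => (c k')⁻¹,
      by simp [Matrix.diagonal_mul_diagonal, hc], by simp [Matrix.diagonal_mul_diagonal, hc]⟩
    let g : (Fin m × Fin n) ⊕ (Fin n × Fin q) → K :=
      Sum.elim (fun p => c p.2) (fun p => (c p.1)⁻¹)
    have hfix : aeval (fun k => C (g k) * X k) f = f := by
      refine MvPolynomial.funext fun x => ?_
      have h := hf A (Matrix.of fun i k => x (Sum.inl (i, k)))
        (Matrix.of fun k l => x (Sum.inr (k, l)))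
      rw [evalX_eq_eval x (Matrix.of fun i k => x (Sum.inl (i, k)))
        (Matrix.of fun k l => x (Sum.inr (k, l))) (fun _ _ => rfl) (fun _ _ => rfl)] at h
      rw [← h, eval_aeval]
      symm
      refine evalX_eq_eval _ _ _ (fun i k => ?_) (fun k l => ?_) f
      · change (_ * Matrix.diagonal c : Matrix (Fin m) (Fin n) K) i k = _
        simp [g, mul_comm]
      · change (Matrix.diagonal (fun k' => (c k')⁻¹) * _ : Matrix (Fin n) (Fin q) K) k l = _
        simp [g]
    have h := congrArg (coeff e) hfix
    rw [coeff_scale] at h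
    have h1 : (e.prod fun k r => g k ^ r) = 1 :=
      mul_left_cancel₀ (mem_support_iff.1 he) (by rw [h, mul_one])
    rw [Finsupp.prod_fintype _ _ (by simp), Fintype.prod_sum_type, Fintype.prod_prod_type_right,
      Fintype.prod_prod_type] at h1
    simp only [g, Sum.elim_inl, Sum.elim_inr, c] at h1
    rw [Fintype.prod_eq_single k, Fintype.prod_eq_single k] at h1
    · simp only [if_true, Finset.prod_pow_eq_pow_sum] at h1
      rw [inv_pow, mul_inv_eq_one₀ (pow_ne_zero _ hs)] at h1
      exact h1
    · intro k' hk'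
      simp [hk']
    · intro k' hk'
      simp [hk']
  by_contra hne
  have hp : (Polynomial.X ^ colWt e k - Polynomial.X ^ rowWt e k : Polynomial K) * Polynomial.X
      = 0 := by
    refine Polynomial.funext fun s => ?_
    by_cases hs : s = 0
    · simp [hs]
    · simp [key s hs]
  rcases mul_eq_zero.1 hp with h | h
  · have h2 := congrArg (fun p => Polynomial.coeff p (colWt e k)) h
    simp [Polynomial.coeff_X_pow, hne] at h2
  · exact Polynomial.X_ne_zero h

/-- Transposition, exchanging the variables of `U` and of `W`. -/
def transposeIx (m n q : ℕ) :
    ((Fin m × Fin n) ⊕ (Fin n × Fin q)) ≃ ((Fin q × Fin n) ⊕ (Fin n × Fin m)) :=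
  (Equiv.sumCongr (Equiv.prodComm _ _) (Equiv.prodComm _ _)).trans (Equiv.sumComm _ _)

theorem IsGLInvariant.transpose {f : KX K n m q} (hf : IsGLInvariant f) :
    IsGLInvariant (rename (transposeIx m n q) f : KX K n q m) := by
  intro A U W
  let B : GL (Fin n) K := ⟨(A⁻¹ : GL (Fin n) K).1.transpose, A.1.transpose,
    by rw [← Matrix.transpose_mul, ← Units.val_mul, mul_inv_cancel, Units.val_one,
      Matrix.transpose_one],
    by rw [← Matrix.transpose_mul, ← Units.val_mul, inv_mul_cancel, Units.val_one,
      Matrix.transpose_one]⟩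
  have h := hf B W.transpose U.transpose
  have hev : ∀ (U : Matrix (Fin q) (Fin n) K) (W : Matrix (Fin n) (Fin m) K),
      evalX K n q m U W (rename (transposeIx m n q) f)
        = evalX K n m q W.transpose U.transpose f := by
    intro U W
    let x : (Fin q × Fin n) ⊕ (Fin n × Fin m) → K :=
      Sum.elim (fun p => U p.1 p.2) (fun p => W p.1 p.2)
    rw [evalX_eq_eval (x ∘ transposeIx m n q) W.transpose U.transpose (fun _ _ => rfl)
      (fun _ _ => rfl) f]
    exact eval_rename _ _ _
  rw [hev, hev, ← h, Matrix.transpose_mul, Matrix.transpose_mul]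
  rfl

end Invariance
section Semistandard

variable {K : Type} [Field K] {n m q : ℕ}

theorem natDegree_aeval_le {ι R : Type*} [Fintype ι] [CommRing R]
    (g : ι → Polynomial (MvPolynomial ι R)) (δ : ι → ℕ) (hg : ∀ k, (g k).natDegree ≤ δ k)
    (f : MvPolynomial ι R) (N : ℕ) (hN : ∀ e ∈ f.support, ∑ k, e k * δ k ≤ N) :
    (aeval g f).natDegree ≤ N := by
  rw [f.as_sum, map_sum]
  refine Polynomial.natDegree_sum_le_of_forall_le _ _ fun e he => ?_
  rw [aeval_monomial, Finsupp.prod_fintype _ _ (by simp), Polynomial.algebraMap_apply]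
  refine (Polynomial.natDegree_C_mul_le _ _).trans ((Polynomial.natDegree_prod_le _ _).trans
    ((Finset.sum_le_sum fun k _ => ?_).trans (hN e he)))
  exact Polynomial.natDegree_pow_le_of_le _ (hg k)

theorem X_pow_dvd_aeval {ι R : Type*} [Fintype ι] [CommRing R]
    (g : ι → Polynomial (MvPolynomial ι R)) (δ : ι → ℕ) (hg : ∀ k, Polynomial.X ^ δ k ∣ g k)
    (f : MvPolynomial ι R) (N : ℕ) (hN : ∀ e ∈ f.support, ∑ k, e k * δ k = N) :
    Polynomial.X ^ N ∣ aeval g f := by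
  rw [f.as_sum, map_sum]
  refine Finset.dvd_sum fun e he => ?_
  rw [aeval_monomial, Finsupp.prod_fintype _ _ (by simp), ← hN e he,
    ← Finset.prod_pow_eq_pow_sum]
  refine Dvd.dvd.mul_left (Finset.prod_dvd_prod_of_dvd _ _ fun k _ => ?_) _
  rw [mul_comm, pow_mul]
  exact pow_dvd_pow_of_dvd (hg k) _

theorem coeff_rename_of_injOn {ι R : Type*} [CommRing R] (g : ι → ι) (f : MvPolynomial ι R)
    (e₀ : ι →₀ ℕ)
    (h : ∀ e ∈ f.support, e.mapDomain g = e₀.mapDomain g → e = e₀) :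
    coeff (e₀.mapDomain g) (rename g f) = coeff e₀ f := by
  classical
  rw [coeff_map_eq_sum]
  simp only [rename_monomial, coeff_monomial, mul_ite, mul_one, mul_zero]
  rw [Finset.sum_eq_single e₀]
  · simp
  · intro e he hne
    rw [if_neg fun hh => hne (h e he hh)]
  · intro he
    simpa using he

theorem sum_mul_ite_left (T : Finset (Fin m)) (j : Fin n)
    (e : (Fin m × Fin n) ⊕ (Fin n × Fin q) →₀ ℕ) :
    ∑ k, e k * Sum.elim (fun p : Fin m × Fin n => if p.2 = j ∧ p.1 ∈ T then 1 else 0)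
      (fun _ => 0) k = ∑ i ∈ T, e (Sum.inl (i, j)) := by
  rw [Fintype.sum_sum_type, Fintype.sum_prod_type]
  simp [ite_and, Finset.sum_ite_mem]

/-- A polynomial invariant under the shear of column `j` into column `j'` in the rows up to `I`,
homogeneous in these two columns, whose degree in the last entry of column `j'` is attained at
`e₀`, satisfies the semistandardness inequality at row `I`. -/
theorem sum_le_of_shearU_eq {j j' : Fin n} (hj : j ≠ j') {I : Fin m} {F : KX K n m q}
    (hF : shearU (· ≤ I) j j' F = F)
    {e₀ : (Fin m × Fin n) ⊕ (Fin n × Fin q) →₀ ℕ} (he₀ : e₀ ∈ F.support)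
    (hx : ∀ e ∈ F.support, ∑ i ∈ Finset.Iic I, e (Sum.inl (i, j))
      = ∑ i ∈ Finset.Iic I, e₀ (Sum.inl (i, j)))
    (hy : ∀ e ∈ F.support, ∑ i ∈ Finset.Iic I, e (Sum.inl (i, j'))
      = ∑ i ∈ Finset.Iic I, e₀ (Sum.inl (i, j')))
    (hI : ∀ e ∈ F.support, e₀ (Sum.inl (I, j)) ≤ e (Sum.inl (I, j))) :
    ∑ i ∈ Finset.Iic I, e₀ (Sum.inl (i, j')) ≤ ∑ i ∈ Finset.Iio I, e₀ (Sum.inl (i, j)) := by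
  classical
  have hsplit : ∀ (e : (Fin m × Fin n) ⊕ (Fin n × Fin q) →₀ ℕ) (k : Fin n),
      ∑ i ∈ Finset.Iic I, e (Sum.inl (i, k))
        = e (Sum.inl (I, k)) + ∑ i ∈ Finset.Iio I, e (Sum.inl (i, k)) := by
    intro e k
    rw [← Finset.Iio_insert, Finset.sum_insert (by simp)]
  let g : (Fin m × Fin n) ⊕ (Fin n × Fin q) → Polynomial (KX K n m q) :=
    Sum.elim (fun p =>
      if p.2 = j ∧ p.1 ∈ Finset.Iio I then
        Polynomial.X * Polynomial.C (X (Sum.inl p)) - Polynomial.C (X (Sum.inl (p.1, j')))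
      else if p = (I, j') then -Polynomial.C (X (Sum.inl (I, j)) : KX K n m q)
      else Polynomial.C (X (Sum.inl p)))
      (fun p => Polynomial.C (X (Sum.inr p)))
  have hdeg : (aeval g F).natDegree ≤ ∑ i ∈ Finset.Iio I, e₀ (Sum.inl (i, j)) := by
    refine natDegree_aeval_le g
      (Sum.elim (fun p : Fin m × Fin n => if p.2 = j ∧ p.1 ∈ Finset.Iio I then 1 else 0)
      (fun _ => 0)) ?_ F _ fun e he => ?_
    · rintro (p | p)
      · simp only [g, Sum.elim_inl]
        split_ifs
        · compute_degree
        · compute_degree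
        · compute_degree
      · simp [g]
    · rw [sum_mul_ite_left]
      have h1 := hx e he
      have h2 := hI e he
      rw [hsplit, hsplit] at h1
      omega
  have hdvd : Polynomial.X ^ (∑ i ∈ Finset.Iic I, e₀ (Sum.inl (i, j'))) ∣ aeval g F := by
    conv_rhs => rw [← hF]
    rw [shearU, ← AlgHom.restrictScalars_apply K (aeval g), ← AlgHom.comp_apply, comp_aeval]
    refine X_pow_dvd_aeval _
      (Sum.elim (fun p : Fin m × Fin n => if p.2 = j' ∧ p.1 ∈ Finset.Iic I then 1 else 0)
      (fun _ => 0)) ?_ F _ fun e he => ?_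
    · rintro (⟨i, k⟩ | p)
      · simp only [Sum.elim_inl, Finset.mem_Iic]
        split_ifs with h
        · obtain ⟨rfl, hi⟩ := h
          rcases hi.lt_or_eq with hi | rfl
          · simp [g, hi, hj.symm, hi.ne]
          · simp [g, hj, hj.symm]
        · simp
      · simp
    · rw [sum_mul_ite_left]
      exact hy e he
  have hne : aeval g F ≠ 0 := by
    let η : Polynomial (KX K n m q) →ₐ[K] KX K n m q :=
      ((Polynomial.aeval (1 : KX K n m q)).restrictScalars K).comp
        (Polynomial.mapAlgHom (aeval (Sum.elim
        (fun p => if p.2 = j ∧ p.1 ∈ Finset.Iio I then X (Sum.inl p) + X (Sum.inl (p.1, j'))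
          else X (Sum.inl p)) (fun p => X (Sum.inr p))) : KX K n m q →ₐ[K] KX K n m q))
    let c : (Fin m × Fin n) ⊕ (Fin n × Fin q) → K :=
      fun k => if k = Sum.inl (I, j') then -1 else 1
    let t : (Fin m × Fin n) ⊕ (Fin n × Fin q) → (Fin m × Fin n) ⊕ (Fin n × Fin q) :=
      fun k => if k = Sum.inl (I, j') then Sum.inl (I, j) else k
    have hη : η (aeval g F) = rename t (aeval (fun k => C (c k) * X k) F) := by
      have hcomp : η.comp ((aeval g).restrictScalars K)
          = (rename t).comp (aeval (fun k => C (c k) * X k)) := by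
        refine algHom_ext fun k => ?_
        rcases k with ⟨i, k⟩ | p
        · by_cases h1 : k = j ∧ i < I
          · obtain ⟨rfl, hi⟩ := h1
            simp [η, g, c, t, hi, hi.ne, hj, hj.symm]
          · by_cases h2 : (i, k) = (I, j')
            · obtain ⟨rfl, rfl⟩ := Prod.mk.inj h2
              simp [η, g, c, t, hj.symm]
            · simp [η, g, c, t, h1, h2]
        · simp [η, g, c, t]
      exact DFunLike.congr_fun hcomp F
    intro h0
    rw [h0, map_zero] at hη
    have hcoeff := coeff_rename_of_injOn t (aeval (fun k => C (c k) * X k) F) e₀ ?_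
    · rw [← hη, coeff_zero, coeff_scale] at hcoeff
      rcases mul_eq_zero.1 hcoeff.symm with h | h
      · exact mem_support_iff.1 he₀ h
      · rw [Finsupp.prod, Finset.prod_eq_zero_iff] at h
        obtain ⟨k, -, hk⟩ := h
        refine pow_ne_zero _ ?_ hk
        by_cases h : k = Sum.inl (I, j') <;> simp [c, h]
    · intro e he hee
      have heF : e ∈ F.support := by
        rw [mem_support_iff, coeff_scale] at he
        exact mem_support_iff.2 (left_ne_zero_of_mul he)
      have hval : ∀ (e : (Fin m × Fin n) ⊕ (Fin n × Fin q) →₀ ℕ) k, k ≠ Sum.inl (I, j) →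
          k ≠ Sum.inl (I, j') → e.mapDomain t k = e k := by
        intro e k h1 h2
        rw [Finsupp.mapDomain, Finsupp.sum_apply, Finsupp.sum_fintype _ _ (by simp)]
        rw [Fintype.sum_eq_single k]
        · simp [t, h2]
        · intro a ha
          rw [Finsupp.single_apply, if_neg]
          simp only [t]
          split_ifs with h
          · exact h1.symm
          · exact ha
      have hrest : ∀ k, k ≠ Sum.inl (I, j) → k ≠ Sum.inl (I, j') → e k = e₀ k := by
        intro k h1 h2
        rw [← hval e k h1 h2, hee, hval e₀ k h1 h2]
      have hIval : ∀ k : Fin n, ∑ i ∈ Finset.Iic I, e (Sum.inl (i, k))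
          = ∑ i ∈ Finset.Iic I, e₀ (Sum.inl (i, k)) → e (Sum.inl (I, k)) = e₀ (Sum.inl (I, k)) := by
        intro k hk
        rw [hsplit, hsplit, Finset.sum_congr rfl fun i hi => hrest (Sum.inl (i, k)) ?_ ?_] at hk
        · omega
        · simp [(Finset.mem_Iio.1 hi).ne]
        · simp [(Finset.mem_Iio.1 hi).ne]
      ext k
      by_cases h1 : k = Sum.inl (I, j)
      · rw [h1]; exact hIval j (hx e heF)
      · by_cases h2 : k = Sum.inl (I, j')
        · rw [h2]; exact hIval j' (hy e heF)
        · exact hrest k h1 h2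
  obtain ⟨r, hr⟩ := hdvd
  have hr0 : r ≠ 0 := by
    rintro rfl
    exact hne (by rw [hr, mul_zero])
  rw [hr, Polynomial.natDegree_X_pow_mul _ hr0] at hdeg
  omega

end Semistandard
section Core

theorem toLex_indicator_le {ι : Type*} [LinearOrder ι] [WellFoundedLT ι] {a b : ι → ℕ}
    (h : toLex a ≤ toLex b) {S : ι → Prop} [DecidablePred S] (hS : ∀ i j, i ≤ j → S j → S i) :
    toLex (fun i => if S i then a i else 0) ≤ toLex (fun i => if S i then b i else 0) := by
  rcases h.eq_or_lt with h | ⟨p, hp, hlt⟩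
  · rw [toLex_inj.1 h]
  · by_cases hSp : S p
    · refine le_of_lt ⟨p, fun i hi => ?_, ?_⟩
      · have : a i = b i := hp i hi
        change (if S i then a i else 0) = if S i then b i else 0
        rw [this]
      · change (if S p then a p else 0) < if S p then b p else 0
        rw [if_pos hSp, if_pos hSp]
        exact hlt
    · refine le_of_eq (congrArg toLex (funext fun i => ?_))
      split_ifs with hi
      · exact hp i (lt_of_not_ge fun hpi => hSp (hS _ _ hpi hi))
      · rfl

theorem apply_le_of_toLex_le {ι : Type*} [LinearOrder ι] [WellFoundedLT ι] {a b : ι → ℕ}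
    (h : toLex a ≤ toLex b) {i : ι} (hi : ∀ k < i, a k = b k) : a i ≤ b i := by
  by_contra! hlt
  exact absurd h (not_le.2 ⟨i, fun k hk => (hi k hk).symm, hlt⟩)

variable {K : Type} [Field K] {n m q : ℕ}

/-- The exponents of the variables of `U`, ordered lexicographically from the last variable on. -/
def uLex (e : (Fin m × Fin n) ⊕ (Fin n × Fin q) →₀ ℕ) : Lex ((Fin m ×ₗ Fin n)ᵒᵈ → ℕ) :=
  toLex fun p => e (Sum.inl (ofLex (OrderDual.ofDual p)))

/-- The exponents of the variables of the transpose of `W`, ordered lexicographically from the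
last variable on. -/
def wLex (e : (Fin m × Fin n) ⊕ (Fin n × Fin q) →₀ ℕ) : Lex ((Fin q ×ₗ Fin n)ᵒᵈ → ℕ) :=
  toLex fun p => e (Sum.inr (ofLex (OrderDual.ofDual p)).swap)

theorem toLex_single_lt {ι : Type*} [LinearOrder ι] [WellFoundedLT ι] {a b : ι → ℕ} {i : ι}
    (ha : ∀ k ≤ i, a k = 0) (hb : ∀ k < i, b k = 0) (hi : b i ≠ 0) : toLex a < toLex b :=
  ⟨i, fun k hk => (ha k hk.le).trans (hb k hk).symm, by
    simpa [ha i le_rfl] using Nat.pos_of_ne_zero hi⟩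

theorem shear_fixed_part [Infinite K] {f : KX K n m q} (hf : IsGLInvariant f) {j j' : Fin n}
    (hj : j < j') {e₀ : (Fin m × Fin n) ⊕ (Fin n × Fin q) →₀ ℕ}
    (hmax : ∀ e ∈ f.support, toLex (rowWt e) ≤ toLex (rowWt e₀))
    [DecidablePred fun e : (Fin m × Fin n) ⊕ (Fin n × Fin q) →₀ ℕ =>
      (fun p => e (Sum.inr p)) = fun p => e₀ (Sum.inr p)] :
    shearU (fun _ => True) j j' (part (fun e => (fun p => e (Sum.inr p))
      = fun p => e₀ (Sum.inr p)) f)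
      = part (fun e => (fun p => e (Sum.inr p)) = fun p => e₀ (Sum.inr p)) f := by
  let G : ((Fin m × Fin n) ⊕ (Fin n × Fin q) →₀ ℕ) →+ (Fin n × Fin q → ℕ) :=
    { toFun := fun e p => e (Sum.inr p)
      map_zero' := rfl
      map_add' := fun _ _ => rfl }
  let ω : ((Fin m × Fin n) ⊕ (Fin n × Fin q) →₀ ℕ) →+ Lex (Fin n → ℕ) :=
    { toFun := fun e => toLex (rowWt e)
      map_zero' := by
        refine congrArg toLex (funext fun k => ?_)
        simp [rowWt]
      map_add' := fun a b => by
        rw [← toLex_add]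
        refine congrArg toLex (funext fun k => ?_)
        simp [rowWt, Finset.sum_add_distrib] }
  have hGω : ∀ d d', G d = G d' → ω d = ω d' := fun d d' h =>
    congrArg toLex (funext fun k => Finset.sum_congr rfl fun l _ => congrFun h (k, l))
  refine fixed_part G ω hGω (ε := shear j j') ?_ ?_ (hf.shear_eq hj.ne) hmax
  · intro k d hd
    have hG : ∀ p : Fin m × Fin n, G (Finsupp.single (Sum.inl p) 1) = 0 := fun p => by
      funext r
      change (Finsupp.single (Sum.inl p) 1 : (Fin m × Fin n) ⊕ (Fin n × Fin q) →₀ ℕ)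
        (Sum.inr r) = 0
      simp
    rcases k with p | p
    · simp only [shearU, aeval_X, Sum.elim_inl] at hd
      split_ifs at hd
      · rcases Finset.mem_union.1 (support_add hd) with hd | hd <;>
          (rw [support_X, Finset.mem_singleton] at hd; simp only [hd, hG])
      · rw [support_X, Finset.mem_singleton] at hd
        rw [hd]
    · simp only [shearU, aeval_X, Sum.elim_inr] at hd
      rw [support_X, Finset.mem_singleton] at hd
      rw [hd]
  · intro k d hd
    rcases k with p | ⟨k, l⟩
    · simp [shearU, shear] at hd
    · simp only [shearU, shear, aeval_X, Sum.elim_inr] at hd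
      split_ifs at hd with h
      · subst h
        rw [sub_sub_cancel_left, support_neg, support_X, Finset.mem_singleton] at hd
        rw [hd]
        refine toLex_single_lt (i := k) (fun r hr => ?_) (fun r hr => ?_) ?_
        · simp [rowWt, (hr.trans_lt hj).ne']
        · simp [rowWt, hr.ne']
        · simp [rowWt, Finsupp.single_apply]
      · simp at hd

/-- The inequality satisfied by the `U`-part of the leading exponent of an invariant. -/
theorem IsGLInvariant.sum_le [Infinite K] {f : KX K n m q} (hf : IsGLInvariant f)
    {j j' : Fin n} (hj : j < j') (I : Fin m)
    {e₀ : (Fin m × Fin n) ⊕ (Fin n × Fin q) →₀ ℕ} (he₀ : e₀ ∈ f.support)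
    (hmax : ∀ e ∈ f.support, toLex (rowWt e) ≤ toLex (rowWt e₀))
    (hU : ∀ e ∈ f.support, (∀ p, e (Sum.inr p) = e₀ (Sum.inr p)) → uLex e ≤ uLex e₀) :
    ∑ i ∈ Finset.Iic I, e₀ (Sum.inl (i, j')) ≤ ∑ i ∈ Finset.Iio I, e₀ (Sum.inl (i, j)) := by
  classical
  have hF₁ := shear_fixed_part hf hj hmax
  set F₁ := part (fun e : (Fin m × Fin n) ⊕ (Fin n × Fin q) →₀ ℕ =>
    (fun p => e (Sum.inr p)) = fun p => e₀ (Sum.inr p)) f with hF₁def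
  let G : ((Fin m × Fin n) ⊕ (Fin n × Fin q) →₀ ℕ) →+ ((Fin m × Fin n) ⊕ (Fin n × Fin q) → ℕ) :=
    { toFun := fun e => Sum.elim (fun p =>
        if p.1 ≤ I ∧ p.2 = j' then 0
        else if p.1 ≤ I ∧ p.2 = j then e (Sum.inl p) + e (Sum.inl (p.1, j'))
        else e (Sum.inl p)) (fun p => e (Sum.inr p))
      map_zero' := by
        funext p
        rcases p with p | p <;> simp
      map_add' := fun a b => by
        funext p
        rcases p with p | p
        · simp only [Finsupp.coe_add, Pi.add_apply, Sum.elim_inl]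
          split_ifs <;> omega
        · simp }
  let ω : ((Fin m × Fin n) ⊕ (Fin n × Fin q) →₀ ℕ) →+ Lex ((Fin m ×ₗ Fin n)ᵒᵈ → ℕ) :=
    { toFun := fun e => toLex fun p => if I < (ofLex (OrderDual.ofDual p)).1 then
        e (Sum.inl (ofLex (OrderDual.ofDual p))) else 0
      map_zero' := by
        refine congrArg toLex (funext fun k => ?_)
        simp
      map_add' := fun a b => by
        rw [← toLex_add]
        refine congrArg toLex (funext fun k => ?_)
        simp only [Finsupp.coe_add, Pi.add_apply]
        split_ifs <;> rfl }
  have hGrow : ∀ d d', G d = G d' → ∀ i k, I < i → d (Sum.inl (i, k)) = d' (Sum.inl (i, k)) := by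
    intro d d' h i k hi
    have := congrFun h (Sum.inl (i, k))
    simpa [G, hi.not_ge] using this
  have hGω : ∀ d d', G d = G d' → ω d = ω d' := fun d d' h => by
    refine congrArg toLex (funext fun k => ?_)
    split_ifs with hk
    · exact hGrow d d' h _ _ hk
    · rfl
  have hfix := fixed_part G ω hGω (ε := shearU (fun _ => True) j j')
    (ε' := shearU (· ≤ I) j j') (f := F₁) (e₀ := e₀) ?_ ?_ hF₁ ?_
  · set F := part (fun e => G e = G e₀) F₁ with hFdef
    have hsupp : ∀ e ∈ F.support, e ∈ f.support ∧ G e = G e₀ ∧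
        ∀ p, e (Sum.inr p) = e₀ (Sum.inr p) := by
      intro e he
      rw [hFdef, mem_support_part, hF₁def, mem_support_part] at he
      exact ⟨he.2.2, he.1, fun p => congrFun he.2.1 p⟩
    have he₀F : e₀ ∈ F.support := by
      rw [hFdef, mem_support_part, hF₁def, mem_support_part]
      exact ⟨rfl, rfl, he₀⟩
    have hcol : ∀ e ∈ F.support, ∀ k, ∑ i ∈ Finset.Iic I, e (Sum.inl (i, k))
        = ∑ i ∈ Finset.Iic I, e₀ (Sum.inl (i, k)) := by
      intro e he k
      obtain ⟨hef, hG, hW⟩ := hsupp e he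
      have h1 : colWt e k = colWt e₀ k := by
        rw [hf.colWt_eq_rowWt hef, hf.colWt_eq_rowWt he₀]
        exact Finset.sum_congr rfl fun l _ => hW _
      simp only [colWt] at h1
      rw [← Finset.sum_add_sum_compl (Finset.Iic I),
        ← Finset.sum_add_sum_compl (Finset.Iic I) fun i => e₀ (Sum.inl (i, k)),
        Finset.sum_congr (s₁ := (Finset.Iic I)ᶜ) rfl fun i hi =>
          hGrow e e₀ hG i k (by simpa using hi)] at h1
      exact Nat.add_right_cancel h1
    refine sum_le_of_shearU_eq hj.ne hfix he₀F (fun e he => hcol e he j)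
      (fun e he => hcol e he j') fun e he => ?_
    obtain ⟨hef, hG, hW⟩ := hsupp e he
    have hle : e (Sum.inl (I, j')) ≤ e₀ (Sum.inl (I, j')) := by
      refine apply_le_of_toLex_le (hU e hef hW) (i := OrderDual.toDual (toLex (I, j')))
        fun p hp => ?_
      obtain ⟨⟨i, k⟩, rfl⟩ : ∃ r, p = OrderDual.toDual (toLex r) := ⟨_, rfl⟩
      rw [OrderDual.toDual_lt_toDual, Prod.Lex.toLex_lt_toLex] at hp
      rcases hp with hp | ⟨hp1, hp2⟩
      · exact hGrow e e₀ hG i k hp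
      · have := congrFun hG (Sum.inl (i, k))
        simp only at hp1 hp2
        simpa [G, hp2.ne', (hj.trans hp2).ne'] using this
    have hsum := congrFun hG (Sum.inl (I, j))
    simp only [G, AddMonoidHom.coe_mk, ZeroHom.coe_mk, Sum.elim_inl, le_refl, true_and, hj.ne,
      if_false, if_true] at hsum
    omega
  · intro k d hd
    rcases k with ⟨i, k⟩ | p
    · simp only [shearU, aeval_X, Sum.elim_inl] at hd
      split_ifs at hd with h
      · obtain ⟨rfl, hi⟩ := h
        rcases Finset.mem_union.1 (support_add hd) with hd | hd
        · rw [support_X, Finset.mem_singleton] at hd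
          rw [hd]
        · rw [support_X, Finset.mem_singleton] at hd
          rw [hd]
          funext r
          rcases r with ⟨i', k'⟩ | r
          · simp only [G, AddMonoidHom.coe_mk, ZeroHom.coe_mk, Sum.elim_inl,
              Finsupp.single_apply, Sum.inl.injEq, Prod.mk.injEq]
            grind
          · simp [G]
      · rw [support_X, Finset.mem_singleton] at hd
        rw [hd]
    · simp only [shearU, aeval_X, Sum.elim_inr] at hd
      rw [support_X, Finset.mem_singleton] at hd
      rw [hd]
  · intro k d hd
    rcases k with ⟨i, k⟩ | p
    · have hd' : d = Finsupp.single (Sum.inl (i, j)) 1 ∧ k = j' ∧ I < i := by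
        simp only [shearU, aeval_X, Sum.elim_inl, and_true] at hd
        split_ifs at hd with h h'
        · simp at hd
        · rw [add_sub_cancel_left, support_X, Finset.mem_singleton] at hd
          exact ⟨hd, h, not_le.1 fun hi => h' ⟨h, hi⟩⟩
        · simp_all
        · simp at hd
      obtain ⟨rfl, rfl, hi⟩ := hd'
      refine toLex_single_lt (i := OrderDual.toDual (toLex (i, k))) (fun r hr => ?_)
        (fun r hr => ?_) ?_
      · obtain ⟨⟨a, b⟩, rfl⟩ : ∃ s, r = OrderDual.toDual (toLex s) := ⟨_, rfl⟩
        rw [OrderDual.toDual_le_toDual, Prod.Lex.toLex_le_toLex] at hr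
        simp only [OrderDual.ofDual_toDual, ofLex_toLex, Finsupp.single_apply, Sum.inl.injEq,
          Prod.mk.injEq]
        grind
      · obtain ⟨⟨a, b⟩, rfl⟩ : ∃ s, r = OrderDual.toDual (toLex s) := ⟨_, rfl⟩
        rw [OrderDual.toDual_lt_toDual, Prod.Lex.toLex_lt_toLex] at hr
        simp only [OrderDual.ofDual_toDual, ofLex_toLex, Finsupp.single_apply, Sum.inl.injEq,
          Prod.mk.injEq]
        grind
      · simp [hi]
    · simp [shearU] at hd
  · intro e he
    rw [hF₁def, mem_support_part] at he
    refine toLex_indicator_le (hU e he.2 fun p => congrFun he.1 p) fun r s hrs hs => ?_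
    obtain ⟨⟨a, b⟩, rfl⟩ : ∃ t, r = OrderDual.toDual (toLex t) := ⟨_, rfl⟩
    obtain ⟨⟨a', b'⟩, rfl⟩ : ∃ t, s = OrderDual.toDual (toLex t) := ⟨_, rfl⟩
    rw [OrderDual.toDual_le_toDual, Prod.Lex.toLex_le_toLex] at hrs
    simp only [OrderDual.ofDual_toDual, ofLex_toLex] at hs ⊢
    grind

/-- The inequality satisfied by the `W`-part of the leading exponent of an invariant. -/
theorem IsGLInvariant.sum_le' [Infinite K] {f : KX K n m q} (hf : IsGLInvariant f)
    {j j' : Fin n} (hj : j < j') (I : Fin q)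
    {e₀ : (Fin m × Fin n) ⊕ (Fin n × Fin q) →₀ ℕ} (he₀ : e₀ ∈ f.support)
    (hmax : ∀ e ∈ f.support, toLex (colWt e) ≤ toLex (colWt e₀))
    (hW : ∀ e ∈ f.support, (∀ p, e (Sum.inl p) = e₀ (Sum.inl p)) → wLex e ≤ wLex e₀) :
    ∑ l ∈ Finset.Iic I, e₀ (Sum.inr (j', l)) ≤ ∑ l ∈ Finset.Iio I, e₀ (Sum.inr (j, l)) := by
  classical
  have hmap : ∀ (e : (Fin m × Fin n) ⊕ (Fin n × Fin q) →₀ ℕ) k,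
      e.mapDomain (transposeIx m n q) (transposeIx m n q k) = e k := fun e k =>
    Finsupp.mapDomain_apply (transposeIx m n q).injective _ _
  have hinl : ∀ (e : (Fin m × Fin n) ⊕ (Fin n × Fin q) →₀ ℕ) l k,
      e.mapDomain (transposeIx m n q) (Sum.inl (l, k)) = e (Sum.inr (k, l)) :=
    fun e l k => hmap e (Sum.inr (k, l))
  have hinr : ∀ (e : (Fin m × Fin n) ⊕ (Fin n × Fin q) →₀ ℕ) k i,
      e.mapDomain (transposeIx m n q) (Sum.inr (k, i)) = e (Sum.inl (i, k)) :=
    fun e k i => hmap e (Sum.inl (i, k))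
  have hsupp : (rename (transposeIx m n q) f : KX K n q m).support
      = f.support.image (Finsupp.mapDomain (transposeIx m n q)) :=
    support_rename_of_injective (transposeIx m n q).injective
  have h := hf.transpose.sum_le hj I (e₀ := e₀.mapDomain (transposeIx m n q)) ?_ ?_ ?_
  · simpa only [hinl] using h
  · rw [hsupp]
    exact Finset.mem_image_of_mem _ he₀
  · intro e he
    rw [hsupp] at he
    obtain ⟨e, hef, rfl⟩ := Finset.mem_image.1 he
    have hr : ∀ e : (Fin m × Fin n) ⊕ (Fin n × Fin q) →₀ ℕ,
        rowWt (e.mapDomain (transposeIx m n q)) = colWt e := fun e => by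
      funext k
      simp only [rowWt, colWt, hinr]
    rw [hr, hr]
    exact hmax e hef
  · intro e he heq
    rw [hsupp] at he
    obtain ⟨e, hef, rfl⟩ := Finset.mem_image.1 he
    have hu : ∀ e : (Fin m × Fin n) ⊕ (Fin n × Fin q) →₀ ℕ,
        uLex (e.mapDomain (transposeIx m n q)) = wLex e := fun e =>
      congrArg toLex (funext fun p => hinl e _ _)
    rw [hu, hu]
    refine hW e hef fun p => ?_
    have := heq p.swap
    rwa [hinr, hinr] at this

end Core
section Leading

variable {K : Type} [Field K] {n m q : ℕ}

/-- The sort key of an exponent: torus weight first, then the variables of `U`, then the variables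
of `W`. -/
def sortKey (m n q : ℕ) : ((Fin m × Fin n) ⊕ (Fin n × Fin q) →₀ ℕ) →+
    Lex (Fin n → ℕ) ×ₗ (Lex ((Fin m ×ₗ Fin n)ᵒᵈ → ℕ) ×ₗ Lex ((Fin q ×ₗ Fin n)ᵒᵈ → ℕ)) where
  toFun e := toLex (toLex (colWt e), toLex (uLex e, wLex e))
  map_zero' := by
    have h : colWt (0 : (Fin m × Fin n) ⊕ (Fin n × Fin q) →₀ ℕ) = 0 := by
      funext k
      simp [colWt]
    rw [h]
    rfl
  map_add' a b := by
    have h : colWt (a + b) = colWt a + colWt b := by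
      funext k
      simp [colWt, Finset.sum_add_distrib]
    rw [h]
    rfl

theorem sortKey_injective : Function.Injective (sortKey m n q) := by
  intro a b h
  have h2 := congrArg (fun x => (ofLex x).2) h
  have hu : uLex a = uLex b := congrArg (fun x => (ofLex x).1) h2
  have hw : wLex a = wLex b := congrArg (fun x => (ofLex x).2) h2
  ext p
  rcases p with p | p
  · exact congrFun hu (OrderDual.toDual (toLex p))
  · exact congrFun hw (OrderDual.toDual (toLex p.swap))

theorem sortKey_nonneg (a : (Fin m × Fin n) ⊕ (Fin n × Fin q) →₀ ℕ) : 0 ≤ sortKey m n q a := by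
  have h : ((0 : Lex (Fin n → ℕ)), toLex ((0 : Lex ((Fin m ×ₗ Fin n)ᵒᵈ → ℕ)),
      (0 : Lex ((Fin q ×ₗ Fin n)ᵒᵈ → ℕ)))) ≤ (toLex (colWt a), toLex (uLex a, wLex a)) := by
    refine ⟨?_, Prod.Lex.toLex_mono ⟨?_, ?_⟩⟩ <;>
      exact Pi.toLex_monotone fun _ => Nat.zero_le _
  exact Prod.Lex.toLex_mono h

/-- The monomial order given by `sortKey`. -/
noncomputable def keyOrder (m n q : ℕ) : MonomialOrder ((Fin m × Fin n) ⊕ (Fin n × Fin q)) where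
  syn := AddMonoidHom.mrange (sortKey m n q)
  addCommMonoidSyn := AddSubmonoid.toAddCommMonoid _
  toSyn :=
    { Equiv.ofBijective (sortKey m n q).mrangeRestrict
        ⟨fun _ _ h => sortKey_injective (congrArg Subtype.val h),
          (sortKey m n q).mrangeRestrict_surjective⟩ with
      map_add' := fun a b => Subtype.ext ((sortKey m n q).map_add a b) }
  toSyn_monotone a b h := by
    obtain ⟨c, rfl⟩ := exists_add_of_le h
    change sortKey m n q a ≤ sortKey m n q (a + c)
    rw [map_add]
    exact le_add_of_nonneg_right (sortKey_nonneg c)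

theorem keyOrder_le_iff (a b : (Fin m × Fin n) ⊕ (Fin n × Fin q) →₀ ℕ) :
    (keyOrder m n q).toSyn a ≤ (keyOrder m n q).toSyn b ↔ sortKey m n q a ≤ sortKey m n q b :=
  Iff.rfl

/-- The semistandardness condition on a matrix of exponents. -/
def Semistandard {m n : ℕ} (a : Fin m → Fin n → ℕ) : Prop :=
  ∀ ⦃j j' : Fin n⦄, j < j' → ∀ I, ∑ i ∈ Finset.Iic I, a i j' ≤ ∑ i ∈ Finset.Iio I, a i j

theorem IsGLInvariant.semistandard_degree [Infinite K] {f : KX K n m q} (hf : IsGLInvariant f)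
    (h0 : f ≠ 0) :
    (Semistandard fun i k => (keyOrder m n q).degree f (Sum.inl (i, k))) ∧
    (Semistandard fun l k => (keyOrder m n q).degree f (Sum.inr (k, l))) ∧
    colWt ((keyOrder m n q).degree f) = rowWt ((keyOrder m n q).degree f) := by
  have he₀ := (keyOrder m n q).degree_mem_support h0
  have hmax : ∀ e ∈ f.support, sortKey m n q e ≤ sortKey m n q ((keyOrder m n q).degree f) :=
    fun e he => (keyOrder_le_iff _ _).1 ((keyOrder m n q).le_degree he)
  set e₀ := (keyOrder m n q).degree f
  have hcol : ∀ e ∈ f.support, toLex (colWt e) ≤ toLex (colWt e₀) := fun e he =>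
    Prod.Lex.monotone_fst _ _ (hmax e he)
  have hsnd : ∀ e ∈ f.support, colWt e = colWt e₀ →
      toLex (uLex e, wLex e) ≤ toLex (uLex e₀, wLex e₀) := by
    intro e he heq
    rcases Prod.Lex.le_iff.1 (hmax e he) with h | h
    · exact absurd (congrArg toLex heq) h.ne
    · exact h.2
  refine ⟨fun j j' hj I => hf.sum_le hj I he₀ ?_ ?_, fun j j' hj I => hf.sum_le' hj I he₀ hcol ?_,
    hf.colWt_eq_rowWt he₀⟩
  · intro e he
    rw [← hf.colWt_eq_rowWt he, ← hf.colWt_eq_rowWt he₀]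
    exact hcol e he
  · intro e he hW
    refine Prod.Lex.monotone_fst _ _ (hsnd e he ?_)
    rw [hf.colWt_eq_rowWt he, hf.colWt_eq_rowWt he₀]
    exact funext fun k => Finset.sum_congr rfl fun l _ => hW _
  · intro e he hU
    have h := hsnd e he (funext fun k => Finset.sum_congr rfl fun i _ => hU _)
    rcases Prod.Lex.le_iff.1 h with h | h
    · exact absurd (congrArg toLex (_root_.funext fun p => hU _)) h.ne
    · exact h.2

/-- The `0`-`1` matrix with entries `1` at the positions `(A r, κ r)`. -/
def graphMat {s m n : ℕ} (A : Fin s → Fin m) (κ : Fin s → Fin n) (i : Fin m) (k : Fin n) : ℕ :=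
  if ∃ r, A r = i ∧ κ r = k then 1 else 0

theorem sum_ite_eq_graphMat {s m n : ℕ} {A : Fin s → Fin m} (hA : Function.Injective A)
    (κ : Fin s → Fin n) (i : Fin m) (k : Fin n) :
    ∑ r, (if A r = i ∧ κ r = k then 1 else 0) = graphMat A κ i k := by
  rw [graphMat]
  split_ifs with h
  · obtain ⟨r, rfl, rfl⟩ := h
    rw [Finset.sum_eq_single r]
    · simp
    · intro r' _ hr'
      rw [if_neg fun h => hr' (hA h.1)]
    · simp
  · exact Finset.sum_eq_zero fun r _ => if_neg fun hr => h ⟨r, hr⟩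

theorem eq_castLE_of_semistandard_graphMat {s m n : ℕ} {A : Fin s → Fin m} (hA : StrictMono A)
    {κ : Fin s → Fin n} (hκ : Function.Injective κ) (h : Semistandard (graphMat A κ))
    (hs : s ≤ n) : κ = Fin.castLE hs := by
  have key : ∀ r' k, k < κ r' → ∃ r < r', κ r = k := by
    intro r' k hk
    have h1 : 0 < ∑ i ∈ Finset.Iic (A r'), graphMat A κ i (κ r') :=
      Finset.sum_pos' (fun _ _ => Nat.zero_le _)
        ⟨A r', by simp, by rw [graphMat, if_pos ⟨r', rfl, rfl⟩]; exact one_pos⟩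
    obtain ⟨i, hi, hne⟩ := Finset.exists_ne_zero_of_sum_ne_zero (h1.trans_le (h hk _)).ne'
    rw [graphMat] at hne
    obtain ⟨r, rfl, hr⟩ := (ite_ne_right_iff.1 hne).1
    exact ⟨r, hA.lt_iff_lt.1 (Finset.mem_Iio.1 hi), hr⟩
  funext r
  have himage : Finset.Iio (κ r) = (Finset.Iio r).image κ := by
    ext k
    simp only [Finset.mem_Iio, Finset.mem_image]
    refine ⟨key r k, ?_⟩
    rintro ⟨r₁, hr₁, rfl⟩
    by_contra hlt
    rcases (not_lt.1 hlt).eq_or_lt with heq | hlt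
    · exact hr₁.ne (hκ heq.symm)
    · obtain ⟨r₂, hr₂, heq⟩ := key _ _ hlt
      rw [hκ heq] at hr₂
      exact lt_asymm hr₁ hr₂
  have hcard := congrArg Finset.card himage
  rw [Finset.card_image_of_injective _ hκ, Fin.card_Iio, Fin.card_Iio] at hcard
  exact Fin.ext hcard

/-- The minor of the product matrix `UW` with rows `A` and columns `B`. -/
noncomputable def minor {s : ℕ} (K : Type) [Field K] (n : ℕ) {m q : ℕ} (A : Fin s → Fin m)
    (B : Fin s → Fin q) : KX K n m q :=
  ((Ugen K n m q * Wgen K n m q).submatrix A B).det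

theorem minor_mem_adjoin {s : ℕ} (A : Fin s → Fin m) (B : Fin s → Fin q) :
    minor K n A B ∈ Algebra.adjoin K
      {g : KX K n m q | ∃ (i : Fin m) (j : Fin q), g = phi K n m q i j} := by
  rw [minor, Matrix.det_apply]
  refine sum_mem fun σ _ => ?_
  rw [Units.smul_def]
  refine zsmul_mem (Subalgebra.prod_mem _ fun i _ => ?_) _
  exact Algebra.subset_adjoin ⟨A (σ i), B i, rfl⟩

theorem isGLInvariant_of_mem_adjoin {f : KX K n m q} (hf : f ∈ Algebra.adjoin K
    {g : KX K n m q | ∃ (i : Fin m) (j : Fin q), g = phi K n m q i j}) : IsGLInvariant f := by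
  have hphi : ∀ (U : Matrix (Fin m) (Fin n) K) (W : Matrix (Fin n) (Fin q) K) i j,
      evalX K n m q U W (phi K n m q i j) = (U * W) i j := by
    intro U W i j
    simp [phi, evalX, Matrix.mul_apply, Ugen, Wgen]
  intro A U W
  induction hf using Algebra.adjoin_induction with
  | mem x hx =>
    obtain ⟨i, j, rfl⟩ := hx
    rw [hphi, hphi, Matrix.mul_assoc, ← Matrix.mul_assoc (A : Matrix (Fin n) (Fin n) K),
      ← Units.val_mul, mul_inv_cancel, Units.val_one, Matrix.one_mul]
  | algebraMap r => simp [evalX, algebraMap_eq]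
  | add x y _ _ hx hy => rw [map_add, map_add, hx, hy]
  | mul x y _ _ hx hy => rw [map_mul, map_mul, hx, hy]

theorem minor_ne_zero {s : ℕ} (hs : s ≤ n) {A : Fin s → Fin m} (hA : Function.Injective A)
    {B : Fin s → Fin q} (hB : Function.Injective B) : minor K n A B ≠ 0 := by
  intro h0
  have h := congrArg (evalX K n m q (fun i k => (graphMat A (Fin.castLE hs) i k : K))
    (fun k l => (graphMat B (Fin.castLE hs) l k : K))) h0
  rw [minor, RingHom.map_det, map_zero] at h
  have hone : (evalX K n m q (fun i k => (graphMat A (Fin.castLE hs) i k : K))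
      (fun k l => (graphMat B (Fin.castLE hs) l k : K))).mapMatrix
      ((Ugen K n m q * Wgen K n m q).submatrix A B) = 1 := by
    ext r r'
    simp only [RingHom.mapMatrix_apply, Matrix.map_apply, Matrix.submatrix_apply, Matrix.mul_apply,
      map_sum, map_mul, Ugen, Wgen, Matrix.of_apply, evalX, eval_X, Sum.elim_inl, Sum.elim_inr,
      graphMat, hA.eq_iff, hB.eq_iff, exists_eq_left, Matrix.one_apply]
    rw [Finset.sum_eq_single (Fin.castLE hs r)]
    · simp [eq_comm]
    · intro k _ hk
      simp [hk.symm]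
    · simp
  rw [hone, Matrix.det_one] at h
  exact one_ne_zero h

theorem exists_of_mem_support_minor {s : ℕ} {A : Fin s → Fin m} (hA : Function.Injective A)
    {B : Fin s → Fin q} (hB : Function.Injective B)
    {e : (Fin m × Fin n) ⊕ (Fin n × Fin q) →₀ ℕ} (he : e ∈ (minor K n A B).support) :
    ∃ κ μ : Fin s → Fin n, Function.Injective κ ∧ Function.Injective μ ∧
      (∀ i k, e (Sum.inl (i, k)) = graphMat A κ i k) ∧
      ∀ l k, e (Sum.inr (k, l)) = graphMat B μ l k := by
  classical
  have hexp : minor K n A B = ∑ κ : Fin s → Fin n,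
      (∏ r, (X (Sum.inl (A r, κ r)) : KX K n m q)) *
        Matrix.det (Matrix.of fun r r' => (X (Sum.inr (κ r, B r')) : KX K n m q)) := by
    have h1 : (Ugen K n m q * Wgen K n m q).submatrix A B = fun r => ∑ k : Fin n,
        (X (Sum.inl (A r, k)) : KX K n m q) • fun r' => (X (Sum.inr (k, B r')) : KX K n m q) := by
      funext r r'
      simp [Matrix.mul_apply, Ugen, Wgen]
    rw [minor, h1]
    change Matrix.detRowAlternating.toMultilinearMap _ = _
    rw [MultilinearMap.map_sum]
    refine Finset.sum_congr rfl fun κ _ => ?_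
    rw [MultilinearMap.map_smul_univ]
    rfl
  rw [hexp] at he
  obtain ⟨κ, -, he⟩ := Finset.mem_biUnion.1 (support_sum he)
  by_cases hκ : Function.Injective κ
  · rw [Matrix.det_apply, Finset.mul_sum] at he
    obtain ⟨σ, -, he⟩ := Finset.mem_biUnion.1 (support_sum he)
    have hmon : (∏ r, (X (Sum.inl (A r, κ r)) : KX K n m q)) * (Equiv.Perm.sign σ •
        ∏ r, Matrix.of (fun r r' => (X (Sum.inr (κ r, B r')) : KX K n m q)) (σ r) r)
        = Equiv.Perm.sign σ • monomial (∑ r, Finsupp.single (Sum.inl (A r, κ r)) 1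
          + ∑ r, Finsupp.single (Sum.inr (κ (σ r), B r)) 1) 1 := by
      rw [mul_smul_comm, ← one_mul (1 : K), ← monomial_mul, monomial_sum_one, monomial_sum_one]
      rfl
    rw [hmon, Units.smul_def] at he
    have hee := Finset.mem_singleton.1 (support_monomial_subset (support_smul he))
    refine ⟨κ, κ ∘ σ, hκ, hκ.comp σ.injective, fun i k => ?_, fun l k => ?_⟩
    · rw [hee, ← sum_ite_eq_graphMat hA]
      simp [Finsupp.single_apply]
    · rw [hee, ← sum_ite_eq_graphMat hB]
      simp [Finsupp.single_apply, and_comm]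
  · obtain ⟨r, r', heq, hne⟩ := Function.not_injective_iff.1 hκ
    rw [Matrix.det_zero_of_row_eq hne (funext fun c => by simp [heq]), mul_zero] at he
    simp at he

/-- The leading exponent of the minor with rows `A` and columns `B`. -/
noncomputable def minorExp {s : ℕ} (hs : s ≤ n) (A : Fin s → Fin m) (B : Fin s → Fin q) :
    (Fin m × Fin n) ⊕ (Fin n × Fin q) →₀ ℕ :=
  Finsupp.equivFunOnFinite.symm (Sum.elim (fun p => graphMat A (Fin.castLE hs) p.1 p.2)
    (fun p => graphMat B (Fin.castLE hs) p.2 p.1))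

theorem degree_minor [Infinite K] {s : ℕ} (hs : s ≤ n) {A : Fin s → Fin m} (hA : StrictMono A)
    {B : Fin s → Fin q} (hB : StrictMono B) :
    (keyOrder m n q).degree (minor K n A B) = minorExp hs A B := by
  have h0 : minor K n A B ≠ 0 := minor_ne_zero hs hA.injective hB.injective
  obtain ⟨hU, hW, -⟩ :=
    (isGLInvariant_of_mem_adjoin (minor_mem_adjoin A B)).semistandard_degree h0
  obtain ⟨κ, μ, hκ, hμ, h1, h2⟩ := exists_of_mem_support_minor hA.injective hB.injective
    ((keyOrder m n q).degree_mem_support h0)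
  simp only [h1, h2] at hU hW
  obtain rfl := eq_castLE_of_semistandard_graphMat hA hκ hU hs
  obtain rfl := eq_castLE_of_semistandard_graphMat hB hμ hW hs
  ext p
  rcases p with p | p
  · exact h1 _ _
  · exact h2 _ _

end Leading
section Straightening

variable {K : Type} [Field K] {n m q : ℕ}

theorem exists_first_ne_zero {m : ℕ} {g : Fin m → ℕ} (h : 0 < ∑ i, g i) :
    ∃ i, 0 < g i ∧ ∀ i' < i, g i' = 0 := by
  obtain ⟨i, -, hi⟩ := Finset.exists_ne_zero_of_sum_ne_zero h.ne'
  obtain ⟨i₀, hi₀, hmin⟩ := WellFounded.has_min (wellFounded_lt (α := Fin m))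
    {i | g i ≠ 0} ⟨i, hi⟩
  exact ⟨i₀, Nat.pos_of_ne_zero hi₀, fun i' hi' => by_contra fun hne => hmin i' hne hi'⟩

theorem Semistandard.exists_lt {a : Fin m → Fin n → ℕ} (ha : Semistandard a) {k k' : Fin n}
    (hk : k < k') {I : Fin m} (hI : 0 < a I k') : ∃ i < I, 0 < a i k := by
  have h1 : 0 < ∑ i ∈ Finset.Iic I, a i k' :=
    Finset.sum_pos' (fun _ _ => Nat.zero_le _) ⟨I, by simp, hI⟩
  obtain ⟨i, hi, hne⟩ := Finset.exists_ne_zero_of_sum_ne_zero (h1.trans_le (ha hk I)).ne'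
  exact ⟨i, Finset.mem_Iio.1 hi, Nat.pos_of_ne_zero hne⟩

theorem sum_graphMat_castLE {s : ℕ} (hs : s ≤ n) (A : Fin s → Fin m) (T : Finset (Fin m))
    (r : Fin s) :
    ∑ i ∈ T, graphMat A (Fin.castLE hs) i (Fin.castLE hs r) = if A r ∈ T then 1 else 0 := by
  simp [graphMat, Fin.castLE_inj]

theorem sum_graphMat_of_le {s : ℕ} (hs : s ≤ n) (A : Fin s → Fin m) (T : Finset (Fin m))
    {k : Fin n} (hk : s ≤ k) : ∑ i ∈ T, graphMat A (Fin.castLE hs) i k = 0 := by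
  refine Finset.sum_eq_zero fun i _ => if_neg ?_
  rintro ⟨r, -, rfl⟩
  exact absurd r.2 (not_lt.2 hk)

/-- Removing the first box of every nonzero column preserves semistandardness. -/
theorem Semistandard.exists_peel {a : Fin m → Fin n → ℕ} (ha : Semistandard a) {s : ℕ}
    (hs : s ≤ n) (hpos : ∀ k : Fin n, 0 < ∑ i, a i k ↔ (k : ℕ) < s) :
    ∃ A : Fin s → Fin m, StrictMono A ∧ (∀ i k, graphMat A (Fin.castLE hs) i k ≤ a i k) ∧
      Semistandard fun i k => a i k - graphMat A (Fin.castLE hs) i k := by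
  choose A hA hA0 using fun r : Fin s => exists_first_ne_zero ((hpos (Fin.castLE hs r)).2 r.2)
  have hmono : StrictMono A := by
    intro r r' hr
    obtain ⟨i, hi, hpos⟩ := ha.exists_lt (k := Fin.castLE hs r) (k' := Fin.castLE hs r') hr (hA r')
    refine lt_of_le_of_lt (not_lt.1 fun hlt => ?_) hi
    exact hpos.ne' (hA0 r i hlt)
  have hle : ∀ i k, graphMat A (Fin.castLE hs) i k ≤ a i k := by
    intro i k
    rw [graphMat]
    split_ifs with h
    · obtain ⟨r, rfl, rfl⟩ := h
      exact hA r
    · exact Nat.zero_le _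
  refine ⟨A, hmono, hle, fun k k' hk I => ?_⟩
  have hsub : ∀ (T : Finset (Fin m)) k, ∑ i ∈ T, (a i k - graphMat A (Fin.castLE hs) i k)
      + ∑ i ∈ T, graphMat A (Fin.castLE hs) i k = ∑ i ∈ T, a i k := by
    intro T k
    rw [← Finset.sum_add_distrib]
    exact Finset.sum_congr rfl fun i _ => Nat.sub_add_cancel (hle i k)
  have h0 : ∑ i ∈ Finset.Iic I, a i k' = 0 →
      ∑ i ∈ Finset.Iic I, (a i k' - graphMat A (Fin.castLE hs) i k')
        ≤ ∑ i ∈ Finset.Iio I, (a i k - graphMat A (Fin.castLE hs) i k) := by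
    intro h
    have := hsub (Finset.Iic I) k'
    omega
  by_cases hk' : (k' : ℕ) < s
  · obtain ⟨r', rfl⟩ : ∃ r' : Fin s, k' = Fin.castLE hs r' := ⟨⟨k', hk'⟩, rfl⟩
    obtain ⟨r, rfl⟩ : ∃ r : Fin s, k = Fin.castLE hs r := ⟨⟨k, lt_trans hk hk'⟩, rfl⟩
    by_cases hI : A r' ≤ I
    · have h1 := hsub (Finset.Iic I) (Fin.castLE hs r')
      have h2 := hsub (Finset.Iio I) (Fin.castLE hs r)
      rw [sum_graphMat_castLE, if_pos (Finset.mem_Iic.2 hI)] at h1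
      rw [sum_graphMat_castLE, if_pos (Finset.mem_Iio.2 ((hmono hk).trans_le hI))] at h2
      have := ha hk I
      beta_reduce
      omega
    · refine h0 (Finset.sum_eq_zero fun i hi => hA0 r' i ?_)
      exact (Finset.mem_Iic.1 hi).trans_lt (not_le.1 hI)
  · refine h0 (Nat.eq_zero_of_le_zero ?_)
    have h1 : ∑ i, a i k' = 0 := Nat.eq_zero_of_not_pos fun h => hk' ((hpos k').1 h)
    exact h1 ▸ Finset.sum_le_sum_of_subset (Finset.subset_univ _)

theorem exists_card_of_lower {P : Fin n → Prop} (hP : ∀ k k', k < k' → P k' → P k) :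
    ∃ s ≤ n, ∀ k : Fin n, P k ↔ (k : ℕ) < s := by
  classical
  refine ⟨(Finset.univ.filter P).card, (Finset.card_le_univ _).trans_eq (Fintype.card_fin n),
    fun k => ⟨fun hk => ?_, fun hk => ?_⟩⟩
  · have : Finset.Iic k ⊆ Finset.univ.filter P := fun i hi => by
      rcases (Finset.mem_Iic.1 hi).eq_or_lt with rfl | hlt
      · simpa using hk
      · simpa using hP _ _ hlt hk
    have := Finset.card_le_card this
    rw [Fin.card_Iic] at this
    omega
  · by_contra hPk
    have : Finset.univ.filter P ⊆ Finset.Iio k := fun i hi => by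
      refine Finset.mem_Iio.2 (not_le.1 fun hki => hPk ?_)
      have hi' := (Finset.mem_filter.1 hi).2
      rcases hki.eq_or_lt with rfl | hlt
      · exact hi'
      · exact hP _ _ hlt hi'
    have := Finset.card_le_card this
    rw [Fin.card_Iio] at this
    omega

theorem colWt_minorExp {s : ℕ} (hs : s ≤ n) (A : Fin s → Fin m) (B : Fin s → Fin q) (k : Fin n) :
    colWt (minorExp hs A B) k = if (k : ℕ) < s then 1 else 0 := by
  change ∑ i, graphMat A (Fin.castLE hs) i k = _
  split_ifs with h
  · simpa using sum_graphMat_castLE hs A Finset.univ ⟨k, h⟩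
  · exact sum_graphMat_of_le hs A _ (not_lt.1 h)

theorem rowWt_minorExp {s : ℕ} (hs : s ≤ n) (A : Fin s → Fin m) (B : Fin s → Fin q) (k : Fin n) :
    rowWt (minorExp hs A B) k = if (k : ℕ) < s then 1 else 0 :=
  colWt_minorExp hs B A k

theorem exists_degree_eq [Infinite K] (N : ℕ) (e : (Fin m × Fin n) ⊕ (Fin n × Fin q) →₀ ℕ)
    (hN : e.degree = N) (hU : Semistandard fun i k => e (Sum.inl (i, k)))
    (hW : Semistandard fun l k => e (Sum.inr (k, l))) (hwt : colWt e = rowWt e) :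
    ∃ P ∈ Algebra.adjoin K {g : KX K n m q | ∃ (i : Fin m) (j : Fin q), g = phi K n m q i j},
      P ≠ 0 ∧ (keyOrder m n q).degree P = e := by
  induction N using Nat.strong_induction_on generalizing e with
  | _ N ih =>
    by_cases he : e = 0
    · exact ⟨1, one_mem _, one_ne_zero, by rw [he, MonomialOrder.degree_one]⟩
    obtain ⟨s, hs, hcol⟩ := exists_card_of_lower (P := fun k => 0 < colWt e k) fun k k' hk hpos => by
      obtain ⟨I, -, hI⟩ := Finset.exists_ne_zero_of_sum_ne_zero hpos.ne'
      obtain ⟨i, -, hi⟩ := hU.exists_lt hk (Nat.pos_of_ne_zero hI)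
      exact Finset.sum_pos' (fun _ _ => Nat.zero_le _) ⟨i, Finset.mem_univ _, hi⟩
    have hrow : ∀ k, 0 < rowWt e k ↔ (k : ℕ) < s := fun k => by rw [← hwt, hcol]
    obtain ⟨A, hA, hAle, hA'⟩ := hU.exists_peel hs hcol
    obtain ⟨B, hB, hBle, hB'⟩ := hW.exists_peel hs hrow
    have hle : minorExp hs A B ≤ e := by
      rintro (p | p)
      · exact hAle _ _
      · exact hBle _ _
    obtain ⟨d, rfl⟩ := exists_add_of_le hle
    have hpos : minorExp hs A B ≠ 0 := by
      intro h0
      obtain ⟨k, hk⟩ : ∃ k, 0 < colWt (minorExp hs A B + d) k := by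
        by_contra! hcon
        refine he (Finsupp.ext fun p => ?_)
        rcases p with ⟨i, k⟩ | ⟨k, l⟩
        · exact (Finset.sum_eq_zero_iff.1 (Nat.eq_zero_of_le_zero (hcon k))) i (Finset.mem_univ _)
        · exact (Finset.sum_eq_zero_iff.1 (Nat.eq_zero_of_le_zero (hwt ▸ hcon k))) l
            (Finset.mem_univ _)
      have h1 := colWt_minorExp hs A B k
      rw [if_pos ((hcol k).1 hk), h0] at h1
      simp [colWt] at h1
    have hdeg : d.degree < N := by
      rw [← hN, map_add]
      exact Nat.lt_add_of_pos_left
        (Nat.pos_of_ne_zero fun h => hpos ((Finsupp.degree_eq_zero_iff _).1 h))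
    have hdU : Semistandard fun i k => d (Sum.inl (i, k)) := by
      have h : ∀ i k, minorExp hs A B (Sum.inl (i, k)) = graphMat A (Fin.castLE hs) i k :=
        fun _ _ => rfl
      simpa only [Finsupp.coe_add, Pi.add_apply, h, Nat.add_sub_cancel_left] using hA'
    have hdW : Semistandard fun l k => d (Sum.inr (k, l)) := by
      have h : ∀ l k, minorExp hs A B (Sum.inr (k, l)) = graphMat B (Fin.castLE hs) l k :=
        fun _ _ => rfl
      simpa only [Finsupp.coe_add, Pi.add_apply, h, Nat.add_sub_cancel_left] using hB'
    have hdwt : colWt d = rowWt d := by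
      funext k
      have h := congrFun hwt k
      have hc : colWt (minorExp hs A B + d) k = colWt (minorExp hs A B) k + colWt d k :=
        Finset.sum_add_distrib
      have hr : rowWt (minorExp hs A B + d) k = rowWt (minorExp hs A B) k + rowWt d k :=
        Finset.sum_add_distrib
      rw [hc, hr, colWt_minorExp, rowWt_minorExp] at h
      exact Nat.add_left_cancel h
    obtain ⟨P, hP, hP0, hPd⟩ := ih _ hdeg d rfl hdU hdW hdwt
    have hD0 : minor K n A B ≠ 0 := minor_ne_zero hs hA.injective hB.injective
    refine ⟨minor K n A B * P, mul_mem (minor_mem_adjoin A B) hP, mul_ne_zero hD0 hP0, ?_⟩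
    rw [MonomialOrder.degree_mul hD0 hP0, degree_minor hs hA hB, hPd]

theorem IsGLInvariant.mem_adjoin [Infinite K] {f : KX K n m q} (hf : IsGLInvariant f) :
    f ∈ Algebra.adjoin K
      {g : KX K n m q | ∃ (i : Fin m) (j : Fin q), g = phi K n m q i j} := by
  induction hd : (keyOrder m n q).toSyn ((keyOrder m n q).degree f) using WellFoundedLT.induction
    generalizing f with
  | _ d ih =>
  subst hd
  by_cases h0 : f = 0
  · rw [h0]
    exact zero_mem _
  obtain ⟨hU, hW, hwt⟩ := hf.semistandard_degree h0
  obtain ⟨P, hP, hP0, hPd⟩ := exists_degree_eq (K := K) _ _ rfl hU hW hwt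
  let c := (keyOrder m n q).leadingCoeff f / (keyOrder m n q).leadingCoeff P
  have hcP : C c * P ∈ Algebra.adjoin K
      {g : KX K n m q | ∃ (i : Fin m) (j : Fin q), g = phi K n m q i j} :=
    mul_mem (Subalgebra.algebraMap_mem _ c) hP
  have hg : IsGLInvariant (f - C c * P) := fun A U W => by
    rw [map_sub, map_sub, hf A U W, isGLInvariant_of_mem_adjoin hcP A U W]
  have hmem : f - C c * P ∈ Algebra.adjoin K
      {g : KX K n m q | ∃ (i : Fin m) (j : Fin q), g = phi K n m q i j} := by
    by_cases hg0 : f - C c * P = 0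
    · rw [hg0]
      exact zero_mem _
    have hlt : (keyOrder m n q).toSyn ((keyOrder m n q).degree (f - C c * P))
        < (keyOrder m n q).toSyn ((keyOrder m n q).degree f) := by
      have hne := ((keyOrder m n q).coeff_degree_ne_zero_iff).2 hg0
      refine lt_of_le_of_ne ?_ fun heq => hne ?_
      · by_contra hlt
        rw [not_le] at hlt
        refine hne ?_
        rw [coeff_sub, coeff_C_mul, (keyOrder m n q).coeff_eq_zero_of_lt hlt,
          (keyOrder m n q).coeff_eq_zero_of_lt (by rwa [hPd]), mul_zero, sub_zero]
      · rw [(keyOrder m n q).toSyn.injective heq, coeff_sub, coeff_C_mul]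
        nth_rewrite 2 [← hPd]
        exact sub_eq_zero.2 (div_mul_cancel₀ _ ((keyOrder m n q).leadingCoeff_ne_zero_iff.2 hP0)).symm
    exact ih _ hlt hg rfl
  simpa using add_mem hmem hcP

end Straightening
end SMB

open SMB in
/-- **First fundamental theorem for `GL_n(K)`-invariants.**
Every `GL_n(K)`-invariant polynomial on `X = M_{m,n}(K) × M_{n,q}(K)` lies in the
`K`-subalgebra of `K[X]` generated by the entries `φ_{ij}` of the product matrix `UW`. -/
theorem gl_first_fundamental_theorem (K : Type) [Field K] [IsAlgClosed K]
    (n m q : ℕ) (hn : 0 < n) (hm : n < m) (hq : n < q)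
    (f : KX K n m q) (hf : IsGLInvariant f) :
    f ∈ Algebra.adjoin K
      {g : KX K n m q | ∃ (i : Fin m) (j : Fin q), g = phi K n m q i j} := by
  exact hf.mem_adjoin
end

section
/- Let ψ* : K[x_{ij} : 1 ≤ i ≤ m, 1 ≤ j ≤ q] → K[X] be the K-algebra homomorphism sending x_{ij} to φ_{ij}. Then the kernel of ψ* equals the ideal generated by all (n+1)×(n+1) minors of the generic m×q matrix (x_{ij}). (Second fundamental theorem for GL_n(K)-invariants.) -/
namespace SMB

variable (K : Type) [Field K] (n m q : ℕ)

/-- The `K`-algebra homomorphism `ψ* : K[x_{ij}] → K[X]`, `x_{ij} ↦ φ_{ij}`. -/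
noncomputable def psiStar : MvPolynomial (Fin m × Fin q) K →ₐ[K] KX K n m q :=
  MvPolynomial.aeval fun p => phi K n m q p.1 p.2

end SMB

open Finset

theorem Function.dite_update_eq_update_dite {M ι : Type*} [DecidableEq ι] (p : ι → Prop)
    [DecidablePred p] [DecidableEq {j // p j}] (z : ι → M) (v : {j // p j} → M) (i : {j // p j})
    (x : M) : (fun j => if h : p j then Function.update v i x ⟨j, h⟩ else z j) =
      Function.update (fun j => if h : p j then v ⟨j, h⟩ else z j) i x := by
  funext j
  by_cases hj : j = i
  · subst hj; simp [i.2]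
  · by_cases h : p j
    · have : (⟨j, h⟩ : {j // p j}) ≠ i := fun h' => hj (by rw [← h'])
      simp [h, hj, this]
    · simp [h, hj]

/-- Fixing the arguments of an alternating map outside a subset of the index type. -/
def AlternatingMap.fixOutside {R M N ι : Type*} [CommSemiring R] [AddCommMonoid M] [AddCommMonoid N]
    [Module R M] [Module R N] (f : M [⋀^ι]→ₗ[R] N) (p : ι → Prop)
    [DecidablePred p] (z : ι → M) : M [⋀^{j // p j}]→ₗ[R] N where
  toFun v := f fun j => if h : p j then v ⟨j, h⟩ else z j
  map_update_add' := by
    intro _ v i x y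
    classical
    simp only [Function.dite_update_eq_update_dite, f.map_update_add]
  map_update_smul' := by
    intro _ v i c x
    classical
    simp only [Function.dite_update_eq_update_dite, f.map_update_smul]
  map_eq_zero_of_eq' := by
    intro v i j h hij
    refine f.map_eq_zero_of_eq _ (i := i) (j := j) ?_ (fun h' => hij (Subtype.ext h'))
    simpa [i.2, j.2] using h

/-- An alternating map in more variables than the rank of its domain vanishes. -/
theorem AlternatingMap.eq_zero_of_card_lt {R M N ι κ : Type*} [CommRing R] [AddCommGroup M]
    [AddCommGroup N] [Module R M] [Module R N] [Fintype ι] [Fintype κ]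
    (e : Module.Basis κ R M) (h : Fintype.card κ < Fintype.card ι) (f : M [⋀^ι]→ₗ[R] N) : f = 0 :=
  Module.Basis.ext_alternating e fun v hv =>
    absurd (Fintype.card_le_of_injective v hv) (not_le.mpr h)

/-- Among the finsets of a given cardinality, the one consisting of all points at which `v`
exceeds a threshold has the strictly largest sum. -/
theorem Finset.sum_lt_sum_of_threshold {α : Type*} [DecidableEq α] (v : α → ℕ) (t : ℕ)
    {A B : Finset α} (hcard : #A = #B) (hne : A ≠ B) (hA : ∀ x ∈ A, t ≤ v x)
    (hB : ∀ x ∉ A, v x < t) : ∑ x ∈ B, v x < ∑ x ∈ A, v x := by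
  have h1 : #(A \ B) = #(B \ A) := Finset.card_sdiff_comm hcard
  have hne' : (B \ A).Nonempty := by
    rw [Finset.nonempty_iff_ne_empty, Ne, Finset.sdiff_eq_empty_iff_subset]
    exact fun h => hne (Finset.eq_of_subset_of_card_le h hcard.le).symm
  have h2 : ∑ x ∈ B \ A, v x < #(B \ A) • t :=
    (Finset.sum_lt_sum_of_nonempty hne' fun x hx => hB x (Finset.mem_sdiff.mp hx).2).trans_eq
      (Finset.sum_const t)
  have h3 : #(A \ B) • t ≤ ∑ x ∈ A \ B, v x :=
    Finset.card_nsmul_le_sum _ _ _ fun x hx => hA x (Finset.mem_sdiff.mp hx).1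
  have h4 := Finset.sum_inter_add_sum_sdiff A B v
  have h5 := Finset.sum_inter_add_sum_sdiff B A v
  rw [Finset.inter_comm] at h5
  rw [h1] at h3
  omega

namespace Matrix

/-- The maximal minor of `Y` on the columns `c`. -/
def maxMinor {A : Type*} [CommRing A] {m : ℕ} {C : Type*} (Y : Matrix (Fin m) C A)
    (c : Fin m → C) : A :=
  (Y.submatrix id c).det

theorem maxMinor_eq_detRowAlternating {A : Type*} [CommRing A] {m : ℕ} {C : Type*}
    (Y : Matrix (Fin m) C A) (c : Fin m → C) :
    Y.maxMinor c = detRowAlternating (fun j i => Y i (c j)) := by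
  rw [maxMinor, ← det_transpose]
  rfl

open scoped TensorProduct in
/-- Plücker relation: if `d j' < c j` for all `j' ≤ i ≤ j`, then the product of the maximal minors
on `c` and `d` is a combination of products in which the first column tuple has a smaller sum. -/
theorem maxMinor_mul_maxMinor_mem_span (K : Type*) {A : Type*} [CommRing K] [CommRing A]
    [Algebra K A] {m N : ℕ} (Y : Matrix (Fin m) (Fin N) A) (c d : Fin m → Fin N) (i : Fin m) (t : ℕ)
    (hc : ∀ j, i ≤ j → t ≤ c j) (hd : ∀ j, j ≤ i → (d j : ℕ) < t) :
    Y.maxMinor c * Y.maxMinor d ∈ Submodule.span K {x | ∃ c' d' : Fin m → Fin N,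
      x = Y.maxMinor c' * Y.maxMinor d' ∧ ∑ j, (c' j : ℕ) < ∑ j, (c j : ℕ) ∧
      ∑ j, (c' j : ℕ) + ∑ j, (d' j : ℕ) = ∑ j, (c j : ℕ) + ∑ j, (d j : ℕ)} := by
  classical
  let v : {j // i ≤ j} ⊕ {j // j ≤ i} → Fin N := Sum.elim (fun j => c j) (fun j => d j)
  let cc (σ : Equiv.Perm ({j // i ≤ j} ⊕ {j // j ≤ i})) : Fin m → Fin N :=
    fun j => if h : i ≤ j then v (σ (Sum.inl ⟨j, h⟩)) else c j
  let dd (σ : Equiv.Perm ({j // i ≤ j} ⊕ {j // j ≤ i})) : Fin m → Fin N :=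
    fun j => if h : j ≤ i then v (σ (Sum.inr ⟨j, h⟩)) else d j
  have hcc1 : cc 1 = c := by funext j; simp [cc, v]
  have hdd1 : dd 1 = d := by funext j; simp [dd, v]
  have sum_cc σ : ∑ j, (cc σ j : ℕ) = ∑ j : {j // i ≤ j}, (v (σ (Sum.inl j)) : ℕ) +
      ∑ j : {j // ¬ i ≤ j}, (c j : ℕ) := by
    rw [← Fintype.sum_subtype_add_sum_subtype (fun j => i ≤ j)]
    congr 1
    · exact Finset.sum_congr rfl fun j _ => by simp [cc, j.2]
    · exact Finset.sum_congr rfl fun j _ => by simp only [cc, dif_neg j.2]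
  have sum_dd σ : ∑ j, (dd σ j : ℕ) = ∑ j : {j // j ≤ i}, (v (σ (Sum.inr j)) : ℕ) +
      ∑ j : {j // ¬ j ≤ i}, (d j : ℕ) := by
    rw [← Fintype.sum_subtype_add_sum_subtype (fun j => j ≤ i)]
    congr 1
    · exact Finset.sum_congr rfl fun j _ => by simp [dd, j.2]
    · exact Finset.sum_congr rfl fun j _ => by simp only [dd, dif_neg j.2]
  have sum_v (σ : Equiv.Perm ({j // i ≤ j} ⊕ {j // j ≤ i})) :
      ∑ j : {j // i ≤ j}, (v (σ (Sum.inl j)) : ℕ) + ∑ j : {j // j ≤ i}, (v (σ (Sum.inr j)) : ℕ) =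
      ∑ x, (v x : ℕ) := by
    rw [← Fintype.sum_sum_type (fun x => (v (σ x) : ℕ)), Equiv.sum_comp σ (fun x => (v x : ℕ))]
  have hadd σ : ∑ j, (cc σ j : ℕ) + ∑ j, (dd σ j : ℕ) = ∑ j, (c j : ℕ) + ∑ j, (d j : ℕ) := by
    have h1 := sum_v σ
    have h2 := sum_v 1
    have h3 := sum_cc 1
    have h4 := sum_dd 1
    rw [hcc1] at h3
    rw [hdd1] at h4
    rw [sum_cc, sum_dd, h3, h4]
    omega
  have hlt σ (hσ : σ ∉ (Equiv.Perm.sumCongrHom {j // i ≤ j} {j // j ≤ i}).range) :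
      ∑ j, (cc σ j : ℕ) < ∑ j, (c j : ℕ) := by
    have h3 := sum_cc 1
    rw [hcc1] at h3
    rw [sum_cc, h3]
    gcongr 1
    let S : Finset ({j // i ≤ j} ⊕ {j // j ≤ i}) := univ.map Function.Embedding.inl
    have := Finset.sum_lt_sum_of_threshold (fun x => (v x : ℕ)) t
      (A := S) (B := S.map σ.toEmbedding) (by simp) ?_ ?_ ?_
    · simpa [S] using this
    · intro hS
      apply hσ
      apply Equiv.Perm.mem_sumCongrHom_range_of_perm_mapsTo_inl
      rintro _ ⟨j, rfl⟩
      have : σ (Sum.inl j) ∈ S := by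
        rw [hS]; exact Finset.mem_map_of_mem _ (by simp [S])
      simpa [S] using this
    · rintro (x | x) hx
      · exact hc _ x.2
      · simp [S] at hx
    · rintro (x | x) hx
      · simp [S] at hx
      · exact hd _ x.2
  let V : {j // i ≤ j} ⊕ {j // j ≤ i} → Fin m → A := fun x r => Y r (v x)
  let a := (detRowAlternating (n := Fin m) (R := A)).fixOutside (fun j => i ≤ j)
    (fun j r => Y r (c j))
  let b := (detRowAlternating (n := Fin m) (R := A)).fixOutside (fun j => j ≤ i)
    (fun j r => Y r (d j))
  have ha σ : a (fun j => V (σ (Sum.inl j))) = Y.maxMinor (cc σ) := by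
    rw [maxMinor_eq_detRowAlternating]
    change detRowAlternating _ = _
    congr 1
    funext j r
    by_cases h : i ≤ j <;> simp [h, cc, V]
  have hb σ : b (fun j => V (σ (Sum.inr j))) = Y.maxMinor (dd σ) := by
    rw [maxMinor_eq_detRowAlternating]
    change detRowAlternating _ = _
    congr 1
    funext j r
    by_cases h : j ≤ i <;> simp [h, dd, V]
  have hsummand (σ : Equiv.Perm ({j // i ≤ j} ⊕ {j // j ≤ i})) :
      LinearMap.mul' A A (AlternatingMap.domCoprod.summand a b (Quotient.mk'' σ) V) =
        Equiv.Perm.sign σ • (Y.maxMinor (cc σ) * Y.maxMinor (dd σ)) := by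
    rw [AlternatingMap.domCoprod.summand_mk'', ← ha, ← hb]
    rcases Int.units_eq_one_or (Equiv.Perm.sign σ) with h | h <;> rw [h] <;> simp
  have hzero : ∑ q, LinearMap.mul' A A (AlternatingMap.domCoprod.summand a b q V) = 0 := by
    have h0 := AlternatingMap.eq_zero_of_card_lt (Pi.basisFun A (Fin m)) (?_ : _ < _)
      (a.domCoprod b)
    · have := congrArg (fun f => LinearMap.mul' A A (f V)) h0
      simpa [AlternatingMap.domCoprod_apply, map_sum] using this
    · rw [Fintype.card_sum, Fintype.card_of_subtype (Finset.Ici i) (by simp),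
        Fintype.card_of_subtype (Finset.Iic i) (by simp)]
      simp only [Fintype.card_fin, Fin.card_Ici, Fin.card_Iic]
      omega
  replace hzero := (Finset.add_sum_erase _ _ (a := Quotient.mk'' 1) (by exact Finset.mem_univ _)).trans
    hzero
  rw [hsummand, hcc1, hdd1, Equiv.Perm.sign_one, one_smul, add_eq_zero_iff_eq_neg] at hzero
  rw [hzero]
  refine neg_mem (sum_mem fun q hq => ?_)
  induction q using Quotient.inductionOn' with | _ σ
  rw [hsummand]
  have hmem : Y.maxMinor (cc σ) * Y.maxMinor (dd σ) ∈ Submodule.span K {x | ∃ c' d' : Fin m → Fin N,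
      x = Y.maxMinor c' * Y.maxMinor d' ∧ ∑ j, (c' j : ℕ) < ∑ j, (c j : ℕ) ∧
      ∑ j, (c' j : ℕ) + ∑ j, (d' j : ℕ) = ∑ j, (c j : ℕ) + ∑ j, (d j : ℕ)} := by
    refine Submodule.subset_span ⟨_, _, rfl, hlt σ fun h => Finset.ne_of_mem_erase hq ?_, hadd σ⟩
    rw [eq_comm]
    refine Quotient.sound' ?_
    rw [QuotientGroup.leftRel_apply]
    simpa using h
  rcases Int.units_eq_one_or (Equiv.Perm.sign σ) with h | h <;> rw [h]
  · simpa using hmem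
  · simpa using hmem

/-- A determinant with permuted columns agrees with the original one up to sign. -/
theorem maxMinor_comp_perm {A : Type*} [CommRing A] {m : ℕ} {C : Type*}
    (Y : Matrix (Fin m) C A) (c : Fin m → C) (σ : Equiv.Perm (Fin m)) :
    Y.maxMinor (c ∘ σ) = (Equiv.Perm.sign σ : ℤ) * Y.maxMinor c :=
  det_permute' σ (Y.submatrix id c)

theorem maxMinor_eq_zero_of_not_injective {A : Type*} [CommRing A] {m : ℕ} {C : Type*}
    (Y : Matrix (Fin m) C A) {c : Fin m → C} (hc : ¬ Function.Injective c) :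
    Y.maxMinor c = 0 := by
  obtain ⟨i, j, h, hij⟩ := Function.not_injective_iff.mp hc
  exact det_zero_of_column_eq hij fun k => by simp [h]

end Matrix

@[to_additive]
theorem Fintype.prod_apply_update_update {ι X M : Type*} [Fintype ι] [DecidableEq ι] [CommMonoid M]
    (g : X → M) (f : ι → X) {i j : ι} (hij : i ≠ j) (x y : X) :
    ∏ l, g (Function.update (Function.update f i x) j y l) =
      g x * g y * ∏ l ∈ (univ.erase i).erase j, g (f l) := by
  rw [← Finset.mul_prod_erase univ _ (Finset.mem_univ i),
    ← Finset.mul_prod_erase (univ.erase i) _ (Finset.mem_erase.mpr ⟨hij.symm, Finset.mem_univ j⟩),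
    ← mul_assoc]
  congr 1
  · simp [hij]
  · refine Finset.prod_congr rfl fun l hl => ?_
    simp only [Finset.mem_erase] at hl
    simp [hl.1, hl.2.1]

namespace Matrix

/-- A tableau is standard if each of its tuples is strictly increasing and the tuples form a
weakly increasing chain. -/
def IsStandard {k m N : ℕ} (T : Fin k → Fin m → Fin N) : Prop :=
  Monotone T ∧ ∀ j, StrictMono (T j)

/-- Straightening: products of maximal minors are combinations of standard ones. -/
theorem prod_maxMinor_mem_span_isStandard (K : Type*) {A : Type*} [CommRing K] [CommRing A]
    [Algebra K A] {m N : ℕ} (Y : Matrix (Fin m) (Fin N) A) {k : ℕ} (T : Fin k → Fin m → Fin N) :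
    ∏ j, Y.maxMinor (T j) ∈ Submodule.span K
      (Set.range fun S : {S : Fin k → Fin m → Fin N // IsStandard S} =>
        ∏ j, Y.maxMinor (S.1 j)) := by
  let w (c : Fin m → Fin N) : ℕ := ∑ i, (c i : ℕ)
  let Φ (T : Fin k → Fin m → Fin N) : ℕ := ∑ j, w (T j) ^ 2
  have hΦ T : Φ T ≤ k * (m * N) ^ 2 := by
    refine (Finset.sum_le_card_nsmul univ _ ((m * N) ^ 2) fun j _ => ?_).trans (by simp)
    gcongr
    exact (Finset.sum_le_card_nsmul univ _ N fun i _ => (T j i).2.le).trans (by simp)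
  induction hb : k * (m * N) ^ 2 - Φ T using Nat.strong_induction_on generalizing T with
  | _ b ih =>
  let T₁ j := T j ∘ Tuple.sort (T j)
  let T₂ := T₁ ∘ Tuple.sort (w ∘ T₁)
  have hw₁ j : w (T₁ j) = w (T j) := Equiv.sum_comp (Tuple.sort (T j)) fun i => (T j i : ℕ)
  have hΦ₂ : Φ T₂ = Φ T := by
    refine (Equiv.sum_comp (Tuple.sort (w ∘ T₁)) fun j => w (T₁ j) ^ 2).trans ?_
    simp only [hw₁, Φ]
  have hmono : Monotone (w ∘ T₂) := Tuple.monotone_sort (w ∘ T₁)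
  have hT₂ j : Monotone (T₂ j) := Tuple.monotone_sort (T _)
  have hprod : ∏ j, Y.maxMinor (T₂ j) =
      ((∏ j, Equiv.Perm.sign (Tuple.sort (T j)) : ℤˣ) : ℤ) * ∏ j, Y.maxMinor (T j) := by
    refine (Equiv.prod_comp (Tuple.sort (w ∘ T₁)) fun j => Y.maxMinor (T₁ j)).trans ?_
    simp only [T₁, maxMinor_comp_perm, Finset.prod_mul_distrib]
    push_cast
    rfl
  suffices h : ∏ j, Y.maxMinor (T₂ j) ∈ Submodule.span K
      (Set.range fun S : {S : Fin k → Fin m → Fin N // IsStandard S} =>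
        ∏ j, Y.maxMinor (S.1 j)) by
    rw [hprod] at h
    rcases Int.units_eq_one_or (∏ j, Equiv.Perm.sign (Tuple.sort (T j))) with hs | hs <;>
      simpa [hs] using h
  rw [← hΦ₂] at hb
  generalize T₂ = T at *
  by_cases hstrict : ∀ j, StrictMono (T j)
  swap
  · obtain ⟨j, hj⟩ := not_forall.mp hstrict
    rw [Finset.prod_eq_zero (Finset.mem_univ j) (Y.maxMinor_eq_zero_of_not_injective fun h =>
      hj ((hT₂ j).strictMono_of_injective h))]
    exact zero_mem _
  by_cases hT : Monotone T
  · exact Submodule.subset_span ⟨⟨T, hT, hstrict⟩, rfl⟩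
  obtain ⟨j, j', hjj', hle⟩ : ∃ j j', j ≤ j' ∧ ¬ T j ≤ T j' := by
    simpa [Monotone] using hT
  have hne : j ≠ j' := by rintro rfl; exact hle le_rfl
  obtain ⟨i, hi⟩ : ∃ i, T j' i < T j i := by simpa [Pi.le_def] using hle
  have hex := Y.maxMinor_mul_maxMinor_mem_span K (T j) (T j') i (T j i)
    (fun l hl => (hstrict j).monotone hl)
    (fun l hl => ((hstrict j').monotone hl).trans_lt hi)
  have hsplit := Fintype.prod_apply_update_update Y.maxMinor T hne (T j) (T j')
  simp only [Function.update_eq_self] at hsplit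
  rw [hsplit]
  refine (Submodule.span_le (p := Submodule.comap (LinearMap.mulRight K
    (∏ l ∈ (univ.erase j).erase j', Y.maxMinor (T l))) (Submodule.span K
      (Set.range fun S : {S : Fin k → Fin m → Fin N // IsStandard S} =>
        ∏ j, Y.maxMinor (S.1 j))))).mpr ?_ hex
  rintro _ ⟨c, d, rfl, hlt, hadd⟩
  rw [SetLike.mem_coe, Submodule.mem_comap, LinearMap.mulRight_apply,
    ← Fintype.prod_apply_update_update Y.maxMinor T hne]
  refine ih _ ?_ _ rfl
  have h1 := Fintype.sum_apply_update_update (fun c => w c ^ 2) T hne c d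
  have h2 := Fintype.sum_apply_update_update (fun c => w c ^ 2) T hne (T j) (T j')
  simp only [Function.update_eq_self] at h2
  have h3 : w (T j) ≤ w (T j') := hmono hjj'
  have h4 : w c < w (T j) := hlt
  have h5 : w c + w d = w (T j) + w (T j') := hadd
  have h6 : w (T j) ^ 2 + w (T j') ^ 2 < w c ^ 2 + w d ^ 2 := by
    obtain ⟨e, he⟩ := Nat.exists_eq_add_of_lt h4
    have h7 : w d = w (T j') + (e + 1) := by omega
    rw [h7]
    rw [he] at h3 ⊢
    nlinarith
  have h7 := hΦ (Function.update (Function.update T j c) j' d)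
  have h8 : Φ T < Φ (Function.update (Function.update T j c) j' d) := by
    change ∑ l, w (T l) ^ 2 < ∑ l, w (Function.update (Function.update T j c) j' d l) ^ 2
    omega
  omega

/-- A product of matrices factoring through a smaller index type has determinant zero. -/
theorem det_mul_eq_zero_of_card_lt {A κ ι : Type*} [CommRing A] [Fintype κ] [Fintype ι]
    [DecidableEq κ] [DecidableEq ι] (U : Matrix ι κ A) (W : Matrix κ ι A)
    (h : Fintype.card κ < Fintype.card ι) : (U * W).det = 0 := by
  have h0 := AlternatingMap.eq_zero_of_card_lt (Pi.basisFun A κ) h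
    ((detRowAlternating (n := ι) (R := A)).compLinearMap U.mulVecLin)
  have h1 := congrArg (fun f => f fun j k => W k j) h0
  rw [← det_transpose]
  exact h1

/-- The ideal generated by the `r × r` minors of a matrix. -/
def minorIdeal {A : Type*} [CommRing A] {m q : ℕ} (X : Matrix (Fin m) (Fin q) A) (r : ℕ) :
    Ideal A :=
  Ideal.span {g | ∃ (a : Fin r → Fin m) (b : Fin r → Fin q), StrictMono a ∧ StrictMono b ∧
    g = (X.submatrix a b).det}

theorem det_submatrix_mem_minorIdeal {A : Type*} [CommRing A] {m q r : ℕ}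
    (X : Matrix (Fin m) (Fin q) A) (a : Fin r → Fin m) (b : Fin r → Fin q) :
    (X.submatrix a b).det ∈ X.minorIdeal r := by
  by_cases ha : Function.Injective a
  swap
  · obtain ⟨i, j, h, hij⟩ := Function.not_injective_iff.mp ha
    rw [det_zero_of_row_eq hij (by funext k; simp [h])]
    exact zero_mem _
  by_cases hb : Function.Injective b
  swap
  · obtain ⟨i, j, h, hij⟩ := Function.not_injective_iff.mp hb
    rw [det_zero_of_column_eq hij fun k => by simp [h]]
    exact zero_mem _
  have key : (X.submatrix (a ∘ Tuple.sort a) (b ∘ Tuple.sort b)).det ∈ X.minorIdeal r :=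
    Ideal.subset_span ⟨_, _,
      (Tuple.monotone_sort a).strictMono_of_injective (ha.comp (Equiv.injective _)),
      (Tuple.monotone_sort b).strictMono_of_injective (hb.comp (Equiv.injective _)), rfl⟩
  have h1 := det_permute' (Tuple.sort b) ((X.submatrix a b).submatrix (Tuple.sort a) id)
  have h2 := det_permute (Tuple.sort a) (X.submatrix a b)
  rw [h2] at h1
  change (X.submatrix (a ∘ Tuple.sort a) (b ∘ Tuple.sort b)).det = _ at h1
  rw [h1] at key
  rcases Int.units_eq_one_or (Equiv.Perm.sign (Tuple.sort a)) with hs | hs <;>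
    rcases Int.units_eq_one_or (Equiv.Perm.sign (Tuple.sort b)) with ht | ht <;>
      simpa [hs, ht] using key

/-- The matrix `[1 | X]`. -/
def oneConcat {A : Type*} [CommRing A] {m q : ℕ} (X : Matrix (Fin m) (Fin q) A) :
    Matrix (Fin m) (Fin (m + q)) A :=
  of fun i => Fin.addCases (fun j => (1 : Matrix (Fin m) (Fin m) A) i j) (fun j => X i j)

@[simp]
theorem oneConcat_castAdd {A : Type*} [CommRing A] {m q : ℕ} (X : Matrix (Fin m) (Fin q) A)
    (i j : Fin m) : X.oneConcat i (Fin.castAdd q j) = (1 : Matrix (Fin m) (Fin m) A) i j := by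
  simp [oneConcat]

@[simp]
theorem oneConcat_natAdd {A : Type*} [CommRing A] {m q : ℕ} (X : Matrix (Fin m) (Fin q) A)
    (i : Fin m) (j : Fin q) : X.oneConcat i (Fin.natAdd m j) = X i j := by
  simp [oneConcat]

/-- A minor of `[1 | X]` whose last `s` columns come from `X` lies in the ideal of `s`-minors
of `X`. -/
theorem det_submatrix_oneConcat_mem_minorIdeal {A : Type*} [CommRing A] {m q s : ℕ}
    (X : Matrix (Fin m) (Fin q) A) {r : ℕ} (hr : s ≤ r) (a : Fin r → Fin m)
    (b : Fin r → Fin (m + q)) (hb : ∀ j : Fin r, r ≤ j + s → m ≤ b j) :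
    (X.oneConcat.submatrix a b).det ∈ X.minorIdeal s := by
  induction r, hr using Nat.le_induction with
  | base =>
    choose b' hb' using fun j => (⟨⟨b j - m, by have := hb j (by omega); omega⟩, by
      ext; have := hb j (by omega); simp; omega⟩ : ∃ y : Fin q, b j = Fin.natAdd m y)
    have : X.oneConcat.submatrix a b = X.submatrix a b' := by
      ext i j
      simp [hb']
    rw [this]
    exact X.det_submatrix_mem_minorIdeal a b'
  | succ r _ ih =>
    rw [det_succ_column_zero]
    refine sum_mem fun i _ => Ideal.mul_mem_left _ _ ?_
    rw [submatrix_submatrix]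
    refine ih _ _ fun j hj => hb j.succ ?_
    simp only [Fin.val_succ]
    omega

theorem maxMinor_mul {A : Type*} [CommRing A] {m : ℕ} {C : Type*} (B : Matrix (Fin m) (Fin m) A)
    (Y : Matrix (Fin m) C A) (c : Fin m → C) :
    (B * Y).maxMinor c = B.det * Y.maxMinor c := by
  rw [maxMinor, maxMinor, ← det_mul]
  rfl

theorem map_maxMinor {A A' : Type*} [CommRing A] [CommRing A'] {m : ℕ} {C : Type*} (f : A →+* A')
    (Y : Matrix (Fin m) C A) (c : Fin m → C) : f (Y.maxMinor c) = (Y.map f).maxMinor c := by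
  rw [maxMinor, RingHom.map_det]
  rfl

theorem maxMinor_oneConcat_castAdd {A : Type*} [CommRing A] {m q : ℕ}
    (X : Matrix (Fin m) (Fin q) A) : X.oneConcat.maxMinor (Fin.castAdd q) = 1 := by
  rw [maxMinor, ← det_one (n := Fin m)]
  congr 1
  ext i j
  simp

/-- Every entry of `X` is a maximal minor of `[1 | X]`. -/
theorem maxMinor_oneConcat_update {A : Type*} [CommRing A] {m q : ℕ}
    (X : Matrix (Fin m) (Fin q) A) (i : Fin m) (j : Fin q) :
    X.oneConcat.maxMinor (Function.update (Fin.castAdd q) i (Fin.natAdd m j)) = X i j := by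
  have h := congrFun (congrFun (congrArg DFunLike.coe (cramer_one (n := Fin m) (α := A)))
    fun r => X r j) i
  rw [cramer_apply] at h
  refine Eq.trans (congrArg det ?_) h
  ext r l
  by_cases hl : l = i
  · subst hl; simp
  · simp [hl]

end Matrix

namespace MvPolynomial
open Matrix

/-- Every polynomial in the entries of a generic matrix `X` is a combination of products of a fixed
number of maximal minors of `[1 | X]`. -/
theorem exists_mem_span_prod_maxMinor_oneConcat {K : Type*} [CommRing K] {m q : ℕ}
    (f : MvPolynomial (Fin m × Fin q) K) :
    ∃ k : ℕ, f ∈ Submodule.span K (Set.range fun T : Fin k → Fin m → Fin (m + q) =>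
      ∏ j, (mvPolynomialX (Fin m) (Fin q) K).oneConcat.maxMinor (T j)) := by
  let Z := (mvPolynomialX (Fin m) (Fin q) K).oneConcat
  let M := Submodule.span K (Set.range Z.maxMinor)
  have h1 : (1 : MvPolynomial (Fin m × Fin q) K) ∈ M :=
    Submodule.subset_span ⟨Fin.castAdd q, maxMinor_oneConcat_castAdd _⟩
  have hmono : Monotone fun k : ℕ => M ^ k :=
    pow_right_monotone (Submodule.one_le.mpr h1)
  obtain ⟨k, hk⟩ : ∃ k : ℕ, f ∈ M ^ k := by
    induction f using MvPolynomial.induction_on with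
    | C a => exact ⟨0, by rw [pow_zero]; exact Submodule.algebraMap_mem a⟩
    | add p r hp hr =>
      obtain ⟨k, hk⟩ := hp
      obtain ⟨l, hl⟩ := hr
      exact ⟨max k l, add_mem (hmono (le_max_left k l) hk) (hmono (le_max_right k l) hl)⟩
    | mul_X p i hp =>
      obtain ⟨k, hk⟩ := hp
      refine ⟨k + 1, ?_⟩
      rw [pow_succ]
      exact Submodule.mul_mem_mul hk
        (Submodule.subset_span ⟨_, maxMinor_oneConcat_update _ i.1 i.2⟩)
  refine ⟨k, ?_⟩
  rw [Submodule.span_pow] at hk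
  refine Submodule.span_mono ?_ hk
  intro x hx
  obtain ⟨g, rfl⟩ := Set.mem_pow.mp hx
  choose T hT using fun j => (g j).2
  refine ⟨T, ?_⟩
  simp only [List.prod_ofFn, ← hT]
  rfl

/-- The monomial `e` occurs in `f`, and all other monomials of `f` have smaller weight. -/
def HasLeadingMonomial {R σ : Type*} [CommSemiring R] (ω : (σ →₀ ℕ) →+ ℕ) (f : MvPolynomial σ R)
    (e : σ →₀ ℕ) : Prop :=
  coeff e f ≠ 0 ∧ ∀ d, coeff d f ≠ 0 → d = e ∨ ω d < ω e

namespace HasLeadingMonomial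

variable {R σ : Type*} [CommRing R] {ω : (σ →₀ ℕ) →+ ℕ}

theorem one [Nontrivial R] : HasLeadingMonomial ω (1 : MvPolynomial σ R) 0 := by
  classical
  refine ⟨by simp, fun d hd => Or.inl ?_⟩
  by_contra h
  exact hd (by rw [coeff_one, if_neg (Ne.symm h)])

theorem mul [IsDomain R] {f g : MvPolynomial σ R} {d e : σ →₀ ℕ} (hf : HasLeadingMonomial ω f d)
    (hg : HasLeadingMonomial ω g e) : HasLeadingMonomial ω (f * g) (d + e) := by
  classical
  constructor
  · rw [coeff_mul, Finset.sum_eq_single (d, e)]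
    · exact mul_ne_zero hf.1 hg.1
    · rintro ⟨d', e'⟩ h hne
      rw [Finset.HasAntidiagonal.mem_antidiagonal] at h
      dsimp only at h ⊢
      by_contra h0
      have hω := congrArg ω h
      simp only [map_add] at hω
      rcases hf.2 d' (left_ne_zero_of_mul h0) with rfl | h1
      · exact hne (Prod.ext rfl (add_left_cancel h))
      · rcases hg.2 e' (right_ne_zero_of_mul h0) with rfl | h2
        · omega
        · omega
    · intro h
      exact absurd (Finset.HasAntidiagonal.mem_antidiagonal.mpr (rfl : (d, e).1 + (d, e).2 = d + e)) h
  · intro x hx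
    rw [coeff_mul] at hx
    obtain ⟨⟨d', e'⟩, h, h0⟩ := Finset.exists_ne_zero_of_sum_ne_zero hx
    rw [Finset.HasAntidiagonal.mem_antidiagonal] at h
    dsimp only at h h0
    subst h
    rcases hf.2 d' (left_ne_zero_of_mul h0) with rfl | h1 <;>
      rcases hg.2 e' (right_ne_zero_of_mul h0) with rfl | h2
    · exact Or.inl rfl
    all_goals
      right
      simp only [map_add]
      omega

theorem prod [IsDomain R] {ι : Type*} (s : Finset ι) {f : ι → MvPolynomial σ R} {e : ι → σ →₀ ℕ}
    (h : ∀ i ∈ s, HasLeadingMonomial ω (f i) (e i)) :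
    HasLeadingMonomial ω (∏ i ∈ s, f i) (∑ i ∈ s, e i) := by
  classical
  induction s using Finset.induction_on with
  | empty => simpa using one
  | insert a s ha ih =>
    rw [Finset.prod_insert ha, Finset.sum_insert ha]
    exact (h a (Finset.mem_insert_self a s)).mul
      (ih fun i hi => h i (Finset.mem_insert_of_mem hi))

/-- Polynomials with distinct leading monomials are linearly independent. -/
theorem eq_zero_of_sum_smul_eq_zero [IsDomain R] {ι : Type*} (s : Finset ι)
    {f : ι → MvPolynomial σ R} {e : ι → σ →₀ ℕ} (h : ∀ i ∈ s, HasLeadingMonomial ω (f i) (e i))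
    (he : Set.InjOn e s) (a : ι → R) (hsum : ∑ i ∈ s, a i • f i = 0) : ∀ i ∈ s, a i = 0 := by
  classical
  by_contra! hcon
  have hne : (s.filter fun i => a i ≠ 0).Nonempty := by
    obtain ⟨i, hi, hai⟩ := hcon
    exact ⟨i, Finset.mem_filter.mpr ⟨hi, hai⟩⟩
  obtain ⟨i, hi, hmax⟩ := Finset.exists_max_image _ (fun i => ω (e i)) hne
  rw [Finset.mem_filter] at hi
  have hc := congrArg (coeff (e i)) hsum
  rw [coeff_sum, Finset.sum_eq_single_of_mem i hi.1, coeff_smul, coeff_zero, smul_eq_mul] at hc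
  · exact mul_ne_zero hi.2 (h i hi.1).1 hc
  · intro j hj hji
    rw [coeff_smul, smul_eq_mul]
    by_contra h0
    rcases (h j hj).2 _ (right_ne_zero_of_mul h0) with h1 | h1
    · exact hji (he hj hi.1 h1.symm)
    · exact absurd (hmax j (Finset.mem_filter.mpr ⟨hj, left_ne_zero_of_mul h0⟩)) (not_le.mpr h1)

end HasLeadingMonomial

/-- The matrix with indeterminate entries at the positions satisfying `P` and zeros elsewhere. -/
noncomputable def genericMatrixOn (R : Type*) [CommRing R] {m N : ℕ} (P : Fin m → Fin N → Prop)
    [∀ i c, Decidable (P i c)] : Matrix (Fin m) (Fin N) (MvPolynomial (Fin m × Fin N) R) :=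
  of fun i c => if P i c then X (i, c) else 0

/-- The weight giving the variable at position `(i, c)` weight `i * c`. -/
noncomputable def diagonalWeight (m N : ℕ) : (Fin m × Fin N →₀ ℕ) →+ ℕ :=
  Finsupp.weight fun p => (p.1 : ℕ) * (p.2 : ℕ)

theorem diagonalWeight_sum_single {m N : ℕ} (σ : Fin m → Fin m) (c : Fin m → Fin N) :
    diagonalWeight m N (∑ i, Finsupp.single (σ i, c i) 1) = ∑ i, (σ i : ℕ) * (c i : ℕ) := by
  simp [diagonalWeight, map_sum, Finsupp.weight_single]

/-- The diagonal term of a minor has the strictly largest weight. -/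
theorem diagonalWeight_perm_lt {m N : ℕ} {c : Fin m → Fin N} (hc : StrictMono c)
    {σ : Equiv.Perm (Fin m)} (hσ : σ ≠ 1) :
    diagonalWeight m N (∑ i, Finsupp.single (σ i, c i) 1) <
      diagonalWeight m N (∑ i, Finsupp.single (i, c i) 1) := by
  rw [diagonalWeight_sum_single, diagonalWeight_sum_single (fun i => i)]
  have hmv : Monovary (fun i : Fin m => (i : ℕ)) (fun i => (c i : ℕ)) :=
    fun i j hij => (hc.lt_iff_lt.mp hij).le
  refine hmv.sum_comp_perm_mul_lt_sum_mul_iff.mpr fun h => hσ ?_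
  have hmono : Monotone σ := by
    intro i j hij
    rcases hij.eq_or_lt with rfl | hlt
    · exact le_rfl
    · exact h (hc hlt)
  have := (StrictMono.range_inj (hmono.strictMono_of_injective σ.injective) strictMono_id).mp
    (by rw [σ.surjective.range_eq, Set.range_id])
  ext i
  simp [this]

theorem hasLeadingMonomial_maxMinor_genericMatrixOn {R : Type*} [CommRing R] [Nontrivial R]
    {m N : ℕ} (P : Fin m → Fin N → Prop) [∀ i c, Decidable (P i c)] {c : Fin m → Fin N}
    (hc : StrictMono c) (hP : ∀ i, P i (c i)) :
    HasLeadingMonomial (diagonalWeight m N) ((genericMatrixOn R P).maxMinor c)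
      (∑ i, Finsupp.single (i, c i) 1) := by
  classical
  have hterm (σ : Fin m → Fin m) (d) (hd : coeff d (∏ i, genericMatrixOn R P (σ i) (c i)) ≠ 0) :
      d = ∑ i, Finsupp.single (σ i, c i) 1 := by
    by_cases h : ∀ i, P (σ i) (c i)
    · have : ∏ i, genericMatrixOn R P (σ i) (c i) =
          monomial (∑ i, Finsupp.single (σ i, c i) 1) (1 : R) := by
        simp [genericMatrixOn, h, monomial_sum_one, X]
      rw [this, coeff_monomial] at hd
      by_contra h0
      exact hd (if_neg (Ne.symm h0))
    · obtain ⟨i, hi⟩ := not_forall.mp h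
      rw [Finset.prod_eq_zero (Finset.mem_univ i) (by simp [genericMatrixOn, hi])] at hd
      simp at hd
  have hdet (d) : coeff d ((genericMatrixOn R P).maxMinor c) = ∑ σ : Equiv.Perm (Fin m),
      Equiv.Perm.sign σ • coeff d (∏ i, genericMatrixOn R P (σ i) (c i)) := by
    rw [maxMinor, det_apply, coeff_sum]
    refine Finset.sum_congr rfl fun σ _ => ?_
    rcases Int.units_eq_one_or (Equiv.Perm.sign σ) with h | h <;> simp [h]
  constructor
  · rw [hdet, Finset.sum_eq_single_of_mem 1 (Finset.mem_univ _)]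
    · have : ∏ i, genericMatrixOn R P i (c i) =
          monomial (∑ i, Finsupp.single (i, c i) 1) (1 : R) := by
        simp [genericMatrixOn, hP, monomial_sum_one, X]
      simp [this]
    · intro σ _ hσ
      by_contra h0
      have h1 := hterm σ _ fun h => h0 (by rw [h, smul_zero])
      have h2 := diagonalWeight_perm_lt hc hσ
      rw [← h1] at h2
      exact lt_irrefl _ h2
  · intro d hd
    rw [hdet] at hd
    obtain ⟨σ, _, h0⟩ := Finset.exists_ne_zero_of_sum_ne_zero hd
    have h1 := hterm σ d fun h => h0 (by rw [h, smul_zero])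
    by_cases hσ : σ = 1
    · left
      simpa [hσ] using h1
    · right
      rw [h1]
      exact diagonalWeight_perm_lt hc hσ

end MvPolynomial

/-- A monotone tuple is determined by its multiset of values. -/
theorem Fin.eq_of_monotone_of_sum_single_eq {α : Type*} [PartialOrder α] {k : ℕ}
    {f g : Fin k → α} (hf : Monotone f) (hg : Monotone g)
    (h : ∑ j, Finsupp.single (f j) 1 = ∑ j, Finsupp.single (g j) (1 : ℕ)) : f = g := by
  classical
  have hperm : (List.ofFn f).Perm (List.ofFn g) := by
    rw [← Multiset.coe_eq_coe]
    have key (f : Fin k → α) : ((List.ofFn f : List α) : Multiset α) =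
        Finsupp.toMultiset (∑ j, Finsupp.single (f j) 1) := by
      rw [map_sum]
      simp only [Finsupp.toMultiset_single, one_smul, List.ofFn_eq_map]
      rw [← Multiset.sum_map_singleton (List.map f (List.finRange k) : Multiset α),
        ← Multiset.map_coe, Multiset.map_map]
      rfl
    rw [key, key, h]
  exact List.ofFn_injective (hperm.eq_of_pairwise (le := (· ≤ ·)) (fun a b _ _ => le_antisymm)
    hf.sortedLE_ofFn.pairwise hg.sortedLE_ofFn.pairwise)

theorem Matrix.IsStandard.eq_of_sum_single_eq {k m N : ℕ} {S T : Fin k → Fin m → Fin N}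
    (hS : IsStandard S) (hT : IsStandard T)
    (h : ∑ j, ∑ i, Finsupp.single (i, S j i) 1 = ∑ j, ∑ i, Finsupp.single (i, T j i) (1 : ℕ)) :
    S = T := by
  classical
  have key (i : Fin m) : (fun j => S j i) = fun j => T j i := by
    refine Fin.eq_of_monotone_of_sum_single_eq (fun _ _ hj => hS.1 hj i) (fun _ _ hj => hT.1 hj i) ?_
    ext c
    have hc := DFunLike.congr_fun h (i, c)
    simpa [Finsupp.finsetSum_apply, Finsupp.single_apply, Prod.mk.injEq, ite_and] using hc
  funext j i
  exact congrFun (key i) j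
namespace SMB
open Matrix

theorem minorIdeal_le_ker_psiStar (K : Type) [Field K] (n m q : ℕ) :
    (mvPolynomialX (Fin m) (Fin q) K).minorIdeal (n + 1) ≤ RingHom.ker (psiStar K n m q) := by
  refine Ideal.span_le.mpr ?_
  rintro _ ⟨a, b, -, -, rfl⟩
  rw [SetLike.mem_coe, RingHom.mem_ker, AlgHom.map_det]
  have : (psiStar K n m q).mapMatrix ((mvPolynomialX (Fin m) (Fin q) K).submatrix a b) =
      (Ugen K n m q).submatrix a id * (Wgen K n m q).submatrix id b := by
    ext1 i j
    simp [psiStar, phi, mul_apply]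
  rw [this]
  exact det_mul_eq_zero_of_card_lt _ _ (by simp)

/-- An element of the kernel of `ψ*` vanishes at every matrix that factors through a product of an
`m × m` matrix and an `m × q` matrix with only `n` nonzero rows. -/
theorem aeval_mul_eq_zero_of_mem_ker {K : Type} [Field K] {n m q : ℕ} {F : Type*} [CommRing F]
    [Algebra K F] {f : MvPolynomial (Fin m × Fin q) K} (hf : f ∈ RingHom.ker (psiStar K n m q))
    (B : Matrix (Fin m) (Fin m) F) (Y : Matrix (Fin m) (Fin q) F) (ι : Fin n ↪ Fin m)
    (hY : ∀ i ∉ Set.range ι, ∀ j, Y i j = 0) :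
    MvPolynomial.aeval (fun p => (B * Y) p.1 p.2) f = 0 := by
  have : (MvPolynomial.aeval fun p => (B * Y) p.1 p.2 : MvPolynomial (Fin m × Fin q) K →ₐ[K] F) =
      (MvPolynomial.aeval (Sum.elim (fun p => B p.1 (ι p.2)) fun p => Y (ι p.1) p.2)).comp
        (psiStar K n m q) := by
    refine MvPolynomial.algHom_ext fun p => ?_
    simp only [MvPolynomial.aeval_X, AlgHom.comp_apply, psiStar, phi, mul_apply, map_sum, map_mul,
      Ugen, Wgen, of_apply, Sum.elim_inl, Sum.elim_inr]
    exact (Fintype.sum_of_injective ι ι.injective _ _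
      (fun i hi => by rw [hY i hi, mul_zero]) fun _ => rfl).symm
  rw [this, AlgHom.comp_apply, RingHom.mem_ker.mp hf, map_zero]

/-- A polynomial combination of standard products of minors of `[1 | X]` of size at most `n` which
lies in the kernel of `ψ*` has zero coefficients. -/
theorem eq_zero_of_sum_smul_prod_maxMinor_mem_ker {K : Type} [Field K] {n m q k : ℕ} (hm : n < m)
    (s : Finset {S : Fin k → Fin m → Fin (m + q) // IsStandard S})
    (hs : ∀ S ∈ s, ∀ j i, (S.1 j i : ℕ) < m ∨ m ≤ i + n)
    (a : {S : Fin k → Fin m → Fin (m + q) // IsStandard S} → K)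
    (h : ∑ S ∈ s, a S • ∏ j, (mvPolynomialX (Fin m) (Fin q) K).oneConcat.maxMinor (S.1 j) ∈
      RingHom.ker (psiStar K n m q)) : ∀ S ∈ s, a S = 0 := by
  let P (i : Fin m) (c : Fin (m + q)) : Prop := (c : ℕ) < m ∨ m ≤ i + n
  let Y := MvPolynomial.genericMatrixOn K P
  let F := FractionRing (MvPolynomial (Fin m × Fin (m + q)) K)
  let φ := algebraMap (MvPolynomial (Fin m × Fin (m + q)) K) F
  have hφ : Function.Injective φ := IsFractionRing.injective _ _
  let YF := Y.map φ
  let B := (YF.submatrix id (Fin.castAdd q))⁻¹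
  let Y' := YF.submatrix id (Fin.natAdd m)
  have hdet : (YF.submatrix id (Fin.castAdd q)).det ≠ 0 := by
    have h1 : (YF.submatrix id (Fin.castAdd q)).det = φ (Y.maxMinor (Fin.castAdd q)) :=
      (map_maxMinor φ Y _).symm
    rw [h1, map_ne_zero_iff φ hφ]
    intro h0
    refine (MvPolynomial.hasLeadingMonomial_maxMinor_genericMatrixOn (R := K) P
      (Fin.strictMono_castAdd q) fun i => Or.inl i.2).1 ?_
    change MvPolynomial.coeff _ (Y.maxMinor _) = 0
    rw [h0, MvPolynomial.coeff_zero]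
  have hB : B * YF.submatrix id (Fin.castAdd q) = 1 := nonsing_inv_mul _ (Ne.isUnit hdet)
  have hBdet : B.det ≠ 0 := by
    intro h0
    have := congrArg det hB
    rw [det_mul, h0, zero_mul, det_one] at this
    exact zero_ne_one this
  let e : MvPolynomial (Fin m × Fin q) K →ₐ[K] F :=
    MvPolynomial.aeval fun p => (B * Y') p.1 p.2
  have hZ : (mvPolynomialX (Fin m) (Fin q) K).oneConcat.map e = B * YF := by
    ext i c
    induction c using Fin.addCases with
    | left j =>
      rw [map_apply, oneConcat_castAdd]
      refine Eq.trans ?_ (congrFun (congrFun hB i) j).symm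
      simp only [one_apply]
      split_ifs <;> simp
    | right j =>
      rw [map_apply, oneConcat_natAdd]
      simp only [mvPolynomialX_apply, e, MvPolynomial.aeval_X]
      rfl
  have hminor (c : Fin m → Fin (m + q)) :
      e ((mvPolynomialX (Fin m) (Fin q) K).oneConcat.maxMinor c) = B.det * φ (Y.maxMinor c) := by
    refine (map_maxMinor e.toRingHom _ c).trans ?_
    rw [map_maxMinor φ, ← maxMinor_mul]
    exact congrArg (fun Z => maxMinor Z c) hZ
  let ι : Fin n ↪ Fin m := ⟨fun i => ⟨m - n + i, by omega⟩, fun i j hij => by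
    have := congrArg Fin.val hij
    ext
    simpa using this⟩
  have he := aeval_mul_eq_zero_of_mem_ker h B Y' ι fun i hi j => by
    have : ¬ P i (Fin.natAdd m j) := by
      rintro (h1 | h1)
      · simp at h1
      · exact hi ⟨⟨i - (m - n), by omega⟩, Fin.ext (by
          change m - n + (i - (m - n)) = (i : ℕ)
          omega)⟩
    simp [Y', YF, Y, MvPolynomial.genericMatrixOn, this]
  change e _ = 0 at he
  have hφsum : φ (∑ S ∈ s, a S • ∏ j, Y.maxMinor (S.1 j)) = 0 := by
    have : e (∑ S ∈ s, a S • ∏ j, (mvPolynomialX (Fin m) (Fin q) K).oneConcat.maxMinor (S.1 j)) =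
        B.det ^ k * φ (∑ S ∈ s, a S • ∏ j, Y.maxMinor (S.1 j)) := by
      simp only [map_sum, map_prod, hminor, Finset.prod_mul_distrib, Finset.prod_const,
        Finset.card_univ, Fintype.card_fin, Finset.mul_sum, MvPolynomial.smul_eq_C_mul, map_mul]
      refine Finset.sum_congr rfl fun S _ => ?_
      have hC : e (MvPolynomial.C (a S)) = φ (MvPolynomial.C (a S)) :=
        (e.commutes (a S)).trans
          (IsScalarTower.algebraMap_apply K (MvPolynomial (Fin m × Fin (m + q)) K) F (a S))
      rw [hC]
      ring
    rw [this] at he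
    exact (mul_eq_zero.mp he).resolve_left (pow_ne_zero k hBdet)
  refine MvPolynomial.HasLeadingMonomial.eq_zero_of_sum_smul_eq_zero
    (ω := MvPolynomial.diagonalWeight m (m + q)) s
    (e := fun S => ∑ j, ∑ i, Finsupp.single (i, S.1 j i) 1)
    (fun S hS => MvPolynomial.HasLeadingMonomial.prod _ fun j _ =>
      MvPolynomial.hasLeadingMonomial_maxMinor_genericMatrixOn P (S.2.2 j) (hs S hS j))
    (fun S _ T _ hST => Subtype.ext (S.2.eq_of_sum_single_eq T.2 hST)) a ?_
  exact hφ (hφsum.trans (map_zero φ).symm)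

theorem ker_psiStar (K : Type) [Field K] (n m q : ℕ) (hm : n < m) :
    RingHom.ker (psiStar K n m q) = (mvPolynomialX (Fin m) (Fin q) K).minorIdeal (n + 1) := by
  classical
  refine le_antisymm (fun f hf => ?_) (minorIdeal_le_ker_psiStar K n m q)
  obtain ⟨k, hk⟩ := MvPolynomial.exists_mem_span_prod_maxMinor_oneConcat f
  replace hk := (Submodule.span_le.mpr (by
    rintro _ ⟨T, rfl⟩
    exact prod_maxMinor_mem_span_isStandard K _ T)) hk
  obtain ⟨a, rfl⟩ := (Submodule.mem_span_range_iff_exists_fun K).mp hk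
  let good (S : {S : Fin k → Fin m → Fin (m + q) // IsStandard S}) : Prop :=
    ∀ j i, (S.1 j i : ℕ) < m ∨ m ≤ i + n
  have hbad : ∑ S with ¬ good S,
      a S • ∏ j, (mvPolynomialX (Fin m) (Fin q) K).oneConcat.maxMinor (S.1 j) ∈
        (mvPolynomialX (Fin m) (Fin q) K).minorIdeal (n + 1) := by
    refine sum_mem fun S hS => Submodule.smul_of_tower_mem _ _ ?_
    simp only [good, Finset.mem_filter, Finset.mem_univ, true_and, not_forall, not_or, not_lt,
      not_le] at hS
    obtain ⟨j, i, h1, h2⟩ := hS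
    refine Ideal.mem_of_dvd _ (Finset.dvd_prod_of_mem _ (Finset.mem_univ j)) ?_
    refine det_submatrix_oneConcat_mem_minorIdeal _ hm _ _ fun l hl => h1.trans ?_
    exact (S.2.2 j).monotone (by rw [Fin.le_def]; omega)
  rw [← Finset.sum_filter_add_sum_filter_not _ good] at hf ⊢
  refine add_mem ?_ hbad
  have hgood := eq_zero_of_sum_smul_prod_maxMinor_mem_ker hm _
    (fun S hS => (Finset.mem_filter.mp hS).2) a
    ((Ideal.add_mem_iff_left _ (minorIdeal_le_ker_psiStar K n m q hbad)).mp hf)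
  rw [Finset.sum_eq_zero fun S hS => by rw [hgood S hS, zero_smul]]
  exact zero_mem _

end SMB

open SMB in
/-- **Second fundamental theorem for `GL_n(K)`-invariants.**
The kernel of `ψ* : K[x_{ij}] → K[X]`, `x_{ij} ↦ φ_{ij}`, is the ideal generated by the
`(n+1) × (n+1)` minors of the generic `m × q` matrix `(x_{ij})`. -/
theorem gl_second_fundamental_theorem (K : Type) [Field K] [IsAlgClosed K]
    (n m q : ℕ) (hn : 0 < n) (hm : n < m) (hq : n < q) :
    RingHom.ker (psiStar K n m q) =
      Ideal.span {g : MvPolynomial (Fin m × Fin q) K |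
        ∃ (a : Fin (n + 1) → Fin m) (b : Fin (n + 1) → Fin q),
          StrictMono a ∧ StrictMono b ∧
          g = Matrix.det (Matrix.of fun i j : Fin (n + 1) => MvPolynomial.X (a i, b j))} := by
  exact ker_psiStar K n m q hm
end
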